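/- arXiv:1407.5801 — 2 statements merged into one kernel-verified Lean document; each statement's English description precedes it below -/
import Mathlib

section
/- Let F be a finite field of odd cardinality q, and let S and S' be two 2-semiarcs of size q in PG(2,q) over F. Then there exists a linear automorphism σ of F³ whose induced map on the projectivization maps S onto S'. (That is, up to collineations there is a unique 2-semiarc of size q in PG(2,q), q odd.) -/
noncomputable section

/-- Points of `PG(2,F)`: the projectivization of `F³`. -/
abbrev PGPoint (F : Type*) [Field F] := Projectivization F (Fin 3 → F)

/-- Lines of `PG(2,F)`: the 2-dimensional linear subspaces of `F³`. -/
abbrev PGLine (F : Type*) [Field F] :=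
  {W : Submodule F (Fin 3 → F) // Module.finrank F W = 2}

/-- A point lies on a line when its representative vectors belong to the subspace. -/
def PGMem {F : Type*} [Field F] (p : PGPoint F) (ℓ : PGLine F) : Prop :=
  p.submodule ≤ ℓ.1

/-- A line `ℓ` is a tangent to `S` at `p` if `S ∩ ℓ = {p}`. -/
def PGTangent {F : Type*} [Field F] (S : Set (PGPoint F)) (ℓ : PGLine F) (p : PGPoint F) :
    Prop :=
  S ∩ {x | PGMem x ℓ} = {p}

/-- A 2-semiarc in `PG(2,F)`: a nonempty set of points such that through each of its points
there pass exactly 2 tangent lines. -/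
def IsTwoSemiarc {F : Type*} [Field F] (S : Set (PGPoint F)) : Prop :=
  S.Nonempty ∧ ∀ p ∈ S, {ℓ : PGLine F | PGTangent S ℓ p}.ncard = 2

/-- The determinant of three vectors of `F³`. -/
def det3 {F : Type*} [Field F] (a b c : Fin 3 → F) : F :=
  a 0 * (b 1 * c 2 - b 2 * c 1) - a 1 * (b 0 * c 2 - b 2 * c 0) + a 2 * (b 0 * c 1 - b 1 * c 0)

/-- The value at `x` of the linear form with coefficients `φ`. -/
def lin3 {F : Type*} [Field F] (φ x : Fin 3 → F) : F := φ 0 * x 0 + φ 1 * x 1 + φ 2 * x 2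

/-- The coefficients of the linear form `x ↦ det3 a b x`. -/
def cross3 {F : Type*} [Field F] (a b : Fin 3 → F) : Fin 3 → F :=
  ![a 1 * b 2 - a 2 * b 1, a 2 * b 0 - a 0 * b 2, a 0 * b 1 - a 1 * b 0]

/-- No three of the vectors `p i` are linearly dependent. -/
def IsArc {F ι : Type*} [Field F] (p : ι → Fin 3 → F) : Prop :=
  ∀ i j k, i ≠ j → i ≠ k → j ≠ k → det3 (p i) (p j) (p k) ≠ 0

/-- The product of the determinants `det3 (p i) (p j) (p k)` over all `k` other than `i`, `j`. -/
def secantProd {F ι : Type*} [Field F] [Fintype ι] [DecidableEq ι] (p : ι → Fin 3 → F)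
    (i j : ι) : F :=
  ∏ k, if k = i ∨ k = j then 1 else det3 (p i) (p j) (p k)

section Arcs

variable {F : Type*} [Field F]

lemma lin3_cross3 (a b x : Fin 3 → F) : lin3 (cross3 a b) x = det3 a b x := by
  simp [lin3, cross3, det3]; ring

lemma lin3_add (φ x y : Fin 3 → F) : lin3 φ (x + y) = lin3 φ x + lin3 φ y := by
  simp [lin3]; ring

lemma lin3_smul (φ : Fin 3 → F) (c : F) (x : Fin 3 → F) : lin3 φ (c • x) = c * lin3 φ x := by
  simp [lin3]; ring

lemma det3_swap (a b c : Fin 3 → F) : det3 b a c = -det3 a b c := by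
  simp only [det3]; ring

lemma det3_rotate (a b c : Fin 3 → F) : det3 b c a = det3 a b c := by
  simp only [det3]; ring

lemma det3_self_left (a c : Fin 3 → F) : det3 a a c = 0 := by
  simp only [det3]; ring

lemma det3_self_right (a c : Fin 3 → F) : det3 a c c = 0 := by
  simp only [det3]; ring

lemma det3_self_outer (a c : Fin 3 → F) : det3 a c a = 0 := by
  simp only [det3]; ring

lemma det3_add_right (a b c d : Fin 3 → F) : det3 a b (c + d) = det3 a b c + det3 a b d := by
  simp only [det3, Pi.add_apply]; ring

lemma exists_eq_smul_of_det3_eq_zero {a b : Fin 3 → F} (ha : a ≠ 0)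
    (h : ∀ y, det3 a b y = 0) : ∃ c : F, b = c • a := by
  have h0 := h (Pi.single 0 1)
  have h1 := h (Pi.single 1 1)
  have h2 := h (Pi.single 2 1)
  simp [det3] at h0 h1 h2
  obtain ⟨k, hk⟩ := Function.ne_iff.1 ha
  refine ⟨b k / a k, ?_⟩
  have hk' : a k ≠ 0 := hk
  ext l
  simp only [Pi.smul_apply, smul_eq_mul]
  rw [div_mul_eq_mul_div, eq_div_iff hk']
  fin_cases k <;> fin_cases l <;> simp <;> grind

lemma exists_mul_det3_eq {p u v : Fin 3 → F} (hp : p ≠ 0) (hu : lin3 u p = 0) (hv : lin3 v p = 0)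
    (huv : ∃ x y, lin3 u x * lin3 v y - lin3 u y * lin3 v x ≠ 0) :
    ∃ c, c ≠ 0 ∧ ∀ x y, det3 p x y = c * (lin3 u x * lin3 v y - lin3 u y * lin3 v x) := by
  have key : ∀ x y, det3 (cross3 u v) x y = lin3 u x * lin3 v y - lin3 u y * lin3 v x := by
    intro x y; simp [det3, cross3, lin3]; ring
  obtain ⟨x, y, hxy⟩ := huv
  obtain ⟨c, hc⟩ := exists_eq_smul_of_det3_eq_zero (a := p) (b := cross3 u v) hp (by
    intro y
    have : det3 p (cross3 u v) y = lin3 u y * lin3 v p - lin3 u p * lin3 v y := by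
      simp [det3, cross3, lin3]; ring
    rw [this, hu, hv]; ring)
  have hcd : ∀ x y, c * det3 p x y = lin3 u x * lin3 v y - lin3 u y * lin3 v x := by
    intro x y; rw [← key, hc]; simp [det3]; ring
  have hc0 : c ≠ 0 := by
    rintro rfl
    exact hxy (by rw [← hcd]; ring)
  refine ⟨c⁻¹, inv_ne_zero hc0, fun x y => ?_⟩
  rw [← hcd]; field_simp

lemma secantProd_ne_zero {ι : Type*} [Fintype ι] [DecidableEq ι] {p : ι → Fin 3 → F}
    (hp : IsArc p) {i j : ι} (hij : i ≠ j) : secantProd p i j ≠ 0 := by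
  refine Finset.prod_ne_zero_iff.2 fun k _ => ?_
  split_ifs with h
  · exact one_ne_zero
  · push Not at h
    exact hp i j k hij h.1.symm h.2.symm

lemma secantProd_swap {ι : Type*} [Fintype ι] [DecidableEq ι] (hι : Odd (Fintype.card ι))
    (p : ι → Fin 3 → F) {i j : ι} (hij : i ≠ j) : secantProd p j i = -secantProd p i j := by
  have h : ∀ k, (if k = j ∨ k = i then 1 else det3 (p j) (p i) (p k)) =
      (if k ∈ ({i, j} : Finset ι) then 1 else -1) *
        (if k = i ∨ k = j then 1 else det3 (p i) (p j) (p k)) := by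
    intro k
    by_cases h : k = i ∨ k = j
    · simp [h, or_comm]
    · simp [h, or_comm, det3_swap (p i) (p j)]
  unfold secantProd
  rw [Finset.prod_congr rfl fun k _ => h k, Finset.prod_mul_distrib, Finset.prod_ite]
  simp only [Finset.prod_const_one, one_mul, Finset.prod_const]
  have hc : (Finset.univ.filter fun k => k ∉ ({i, j} : Finset ι)).card = Fintype.card ι - 2 := by
    rw [← Finset.card_pair hij, ← Finset.card_compl]; congr 1; ext; simp
  rw [hc, Odd.neg_one_pow]
  · ring
  · have h2 : 2 ≤ Fintype.card ι := by
      rw [← Finset.card_pair hij]; exact Finset.card_le_univ _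
    obtain ⟨m, hm⟩ := hι
    exact ⟨m - 1, by omega⟩

end Arcs

/-- Through `p i` there are two lines, with equations `u` and `v`, missing all the other `p j`,
while every other line through `p i` contains a further `p j`. -/
def HasTangentForms {F ι : Type*} [Field F] (p : ι → Fin 3 → F) : Prop :=
  ∀ i, p i ≠ 0 ∧ ∃ u v : Fin 3 → F, lin3 u (p i) = 0 ∧ lin3 v (p i) = 0 ∧
    (∀ j, j ≠ i → lin3 u (p j) ≠ 0 ∧ lin3 v (p j) ≠ 0) ∧
    ∀ s : F, s ≠ 0 → ∃ j, j ≠ i ∧ lin3 v (p j) = s * lin3 u (p j)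

section TangentForms

variable {F : Type*} [Field F] [Fintype F]

lemma two_ne_zero_of_odd_card (hodd : Odd (Fintype.card F)) : (2 : F) ≠ 0 := by
  refine Ring.two_ne_zero fun h => ?_
  have := (FiniteField.even_card_iff_char_two (F := F)).1 h
  rw [Nat.odd_iff] at hodd
  omega

lemma prod_eq_mul_prod_units [DecidableEq F] (f : F → F) : ∏ x, f x = f 0 * ∏ x : Fˣ, f x := by
  rw [Fintype.prod_eq_mul_prod_subtype_ne f 0]
  congr 1
  exact (Fintype.prod_equiv unitsEquivNeZero _ _ fun _ => rfl).symm

lemma prod_units_sub_mul [DecidableEq F] (a : Fˣ) :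
    (∏ s : Fˣ, if (s : F) = a then 1 else (s : F) - a) * a = 1 := by
  have h1 : ∏ s : F, (if s = a then 1 else s - a) = ∏ d : F, if d = 0 then 1 else d :=
    Fintype.prod_equiv (Equiv.subRight (a : F)) _ _ fun s => by simp [sub_eq_zero]
  rw [prod_eq_mul_prod_units, prod_eq_mul_prod_units] at h1
  have h2 : ∏ x : Fˣ, (if (x : F) = 0 then 1 else (x : F)) = -1 := by
    have := congrArg (Units.coeHom F) (FiniteField.prod_univ_units_id_eq_neg_one (K := F))
    rw [map_prod] at this
    simpa using this
  rw [h2, if_neg a.ne_zero.symm, if_pos rfl] at h1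
  linear_combination -h1

variable {ι : Type*} [Fintype ι] [DecidableEq ι]

lemma HasTangentForms.exists_secantProd {p : ι → Fin 3 → F} (hp : HasTangentForms p)
    (hodd : Odd (Fintype.card F)) (hcard : Fintype.card ι = Fintype.card F) (i : ι) :
    ∃ (c K : F) (u v : Fin 3 → F), c ≠ 0 ∧ K ≠ 0 ∧
      (∀ x y, det3 (p i) x y = c * (lin3 u x * lin3 v y - lin3 u y * lin3 v x)) ∧
      (∀ j, j ≠ i → lin3 u (p j) ≠ 0 ∧ lin3 v (p j) ≠ 0) ∧
      (∀ j k, j ≠ i → k ≠ i → j ≠ k →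
        lin3 v (p j) / lin3 u (p j) ≠ lin3 v (p k) / lin3 u (p k)) ∧
      ∀ j, j ≠ i → secantProd p i j * (lin3 u (p j) * lin3 v (p j)) = K := by
  classical
  obtain ⟨hpi, u, v, hu, hv, hne, hsurj⟩ := hp i
  have h2 := two_ne_zero_of_odd_card hodd
  obtain ⟨c, hc, hdet⟩ := exists_mul_det3_eq hpi hu hv (by
    obtain ⟨j, hj, hj'⟩ := hsurj 1 one_ne_zero
    obtain ⟨k, hk, hk'⟩ := hsurj (-1) (by simp)
    refine ⟨p j, p k, ?_⟩
    have h3 : lin3 u (p j) * lin3 v (p k) - lin3 u (p k) * lin3 v (p j) =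
        -(2 * (lin3 u (p j) * lin3 u (p k))) := by rw [hj', hk']; ring
    rw [h3]
    exact neg_ne_zero.2 (mul_ne_zero h2 (mul_ne_zero (hne j hj).1 (hne k hk).1)))
  let f : {j // j ≠ i} → Fˣ := fun j =>
    Units.mk0 (lin3 v (p j) / lin3 u (p j)) (div_ne_zero (hne j j.2).2 (hne j j.2).1)
  have hf : Function.Bijective f := by
    rw [Fintype.bijective_iff_surjective_and_card]
    refine ⟨fun s => ?_, ?_⟩
    · obtain ⟨j, hj, h⟩ := hsurj s s.ne_zero
      refine ⟨⟨j, hj⟩, Units.ext ?_⟩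
      simp only [f, Units.val_mk0, h]
      exact mul_div_cancel_right₀ _ (hne j hj).1
    · rw [Fintype.card_units, ← hcard]
      simp [Fintype.card_subtype_compl]
  let U : F := ∏ k : {j // j ≠ i}, lin3 u (p k)
  have hU : U ≠ 0 := Finset.prod_ne_zero_iff.2 fun k _ => (hne k k.2).1
  refine ⟨c, U / c, u, v, hc, div_ne_zero hU hc, hdet, hne, ?_, ?_⟩
  · intro j k hj hk hjk h
    have : f ⟨j, hj⟩ = f ⟨k, hk⟩ := Units.ext h
    exact hjk (congrArg Subtype.val (hf.1 this))
  · intro j hj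
    have hsplit : secantProd p i j =
        (∏ k : {j // j ≠ i}, if k = ⟨j, hj⟩ then 1 else c * lin3 u (p j) * lin3 u (p k)) *
          ∏ k : {j // j ≠ i}, if (f k : F) = f ⟨j, hj⟩ then 1 else (f k : F) - f ⟨j, hj⟩ := by
      unfold secantProd
      rw [Fintype.prod_eq_mul_prod_subtype_ne _ i, ← Finset.prod_mul_distrib]
      simp only [true_or, if_true, one_mul]
      refine Finset.prod_congr rfl fun k _ => ?_
      have hk : (k : ι) ≠ i := k.2
      by_cases hkj : k = ⟨j, hj⟩
      · subst hkj; simp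
      · have h1 : (k : ι) ≠ j := fun h => hkj (Subtype.ext h)
        have h2 : (f k : F) ≠ f ⟨j, hj⟩ := fun h => hkj (hf.1 (Units.ext h))
        rw [if_neg (by simp [hk, h1]), if_neg hkj, if_neg h2, hdet]
        have := (hne j hj).1
        have := (hne k hk).1
        simp only [f, Units.val_mk0]
        field_simp
    have h1 : (∏ k : {j // j ≠ i}, if k = ⟨j, hj⟩ then 1 else c * lin3 u (p j) * lin3 u (p k)) *
        (c * lin3 u (p j) * lin3 u (p j)) = U := by
      have hall : ∏ k : {j // j ≠ i}, c * lin3 u (p j) * lin3 u (p k) = U := by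
        rw [Finset.prod_mul_distrib, Finset.prod_const, Finset.card_univ,
          Fintype.card_congr (Equiv.ofBijective f hf), Fintype.card_units,
          FiniteField.pow_card_sub_one_eq_one _ (mul_ne_zero hc (hne j hj).1), one_mul]
      rw [← hall, Fintype.prod_eq_mul_prod_subtype_ne
          (fun k : {j // j ≠ i} => if k = ⟨j, hj⟩ then 1 else c * lin3 u (p j) * lin3 u (p k))
          ⟨j, hj⟩,
        Fintype.prod_eq_mul_prod_subtype_ne
          (fun k : {j // j ≠ i} => c * lin3 u (p j) * lin3 u (p k)) ⟨j, hj⟩,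
        if_pos rfl, one_mul, mul_comm]
      congr 1
      exact Finset.prod_congr rfl fun k _ => if_neg k.2
    have h3 := prod_units_sub_mul (f ⟨j, hj⟩)
    rw [← Fintype.prod_equiv (Equiv.ofBijective f hf)
      (fun k => if (f k : F) = f ⟨j, hj⟩ then 1 else (f k : F) - f ⟨j, hj⟩) _
      (fun _ => rfl)] at h3
    rw [hsplit, eq_div_iff hc, ← h1]
    simp only [f, Units.val_mk0] at h3 ⊢
    have hu0 := (hne j hj).1
    rw [mul_div_assoc', div_eq_iff hu0] at h3
    linear_combination (∏ k : {j // j ≠ i}, if k = ⟨j, hj⟩ then 1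
      else c * lin3 u (p j) * lin3 u (p k)) * c * lin3 u (p j) * h3

lemma HasTangentForms.isArc {p : ι → Fin 3 → F} (hp : HasTangentForms p)
    (hodd : Odd (Fintype.card F)) (hcard : Fintype.card ι = Fintype.card F) : IsArc p := by
  intro i j k hij hik hjk
  obtain ⟨c, K, u, v, hc, hK, hdet, hne, hinj, -⟩ := hp.exists_secantProd hodd hcard i
  have h1 := (hne j hij.symm).1
  have h2 := (hne k hik.symm).1
  have h := hinj j k hij.symm hik.symm hjk
  rw [hdet]
  refine mul_ne_zero hc fun h0 => h ?_
  rw [div_eq_div_iff h1 h2]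
  linear_combination -h0

/-- The two-variable Lagrange identity for the tangent forms of an arc. -/
lemma HasTangentForms.sum_eq_zero {p : ι → Fin 3 → F} (hp : HasTangentForms p)
    (hodd : Odd (Fintype.card F)) (hcard : Fintype.card ι = Fintype.card F)
    {κ : Type*} [Fintype κ] [DecidableEq κ] (hκ : Fintype.card κ = 7) (t : κ → ι)
    (ht : Function.Injective t) (i : κ) (x y : Fin 3 → F) :
    ∑ j, ((secantProd p (t i) (t j))⁻¹ * (secantProd (p ∘ t) i j)⁻¹) *
      det3 (p (t i)) (p (t j)) x * det3 (p (t i)) (p (t j)) y = 0 := by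
  obtain ⟨c, K, u, v, hc, hK, hdet, hne, hinj, hprod⟩ := hp.exists_secantProd hodd hcard (t i)
  have hti : ∀ {j}, j ≠ i → t j ≠ t i := fun h => ht.ne h
  let a : κ → F := fun j => lin3 u (p (t j))
  let s : κ → F := fun j => lin3 v (p (t j)) / lin3 u (p (t j))
  let N : Finset κ := Finset.univ.erase i
  have hN : N.card = 6 := by simp [N, hκ]
  have ha : ∀ j ∈ N, a j ≠ 0 := fun j hj => (hne _ (hti (Finset.ne_of_mem_erase hj))).1
  have hs : Set.InjOn s N := by
    intro j hj k hk hjk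
    by_contra h
    exact hinj _ _ (hti (Finset.ne_of_mem_erase hj)) (hti (Finset.ne_of_mem_erase hk))
      (ht.ne h) hjk
  let P : Polynomial F := Polynomial.X * (Polynomial.C (lin3 v x) -
    Polynomial.C (lin3 u x) * Polynomial.X) * (Polynomial.C (lin3 v y) -
    Polynomial.C (lin3 u y) * Polynomial.X)
  have hPd : P.natDegree ≤ 3 := by
    simp only [P]
    compute_degree
  have hlag := Lagrange.coeff_eq_sum hs (P := P) (by
    refine lt_of_le_of_lt Polynomial.degree_le_natDegree ?_
    rw [hN]; exact_mod_cast (by omega : P.natDegree < 6))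
  rw [hN, Polynomial.coeff_eq_zero_of_natDegree_lt (by omega)] at hlag
  rw [← Finset.add_sum_erase _ _ (Finset.mem_univ i)]
  simp only [det3_self_left, mul_zero, zero_add]
  have hU : ∏ k ∈ N, a k ≠ 0 := Finset.prod_ne_zero_iff.2 ha
  rw [← mul_zero (-(K * c ^ 3 * ∏ k ∈ N, a k)⁻¹), hlag, Finset.mul_sum]
  refine Finset.sum_congr rfl fun j hj => ?_
  have hji := Finset.ne_of_mem_erase hj
  have hprod2 : secantProd (p ∘ t) i j * a j =
      -(c ^ 5 * a j ^ 5 * (∏ k ∈ N, a k) * ∏ k ∈ N.erase j, (s j - s k)) := by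
    have hcard5 : (N.erase j).card = 5 := by rw [Finset.card_erase_of_mem hj, hN]
    rw [← Finset.mul_prod_erase N a hj]
    unfold secantProd
    rw [← Finset.mul_prod_erase _ _ (Finset.mem_univ i), ← Finset.mul_prod_erase N _ hj]
    simp only [true_or, or_true, if_true, one_mul, Function.comp_apply]
    rw [Finset.prod_congr rfl (g := fun k => (-(c * a j)) * (a k * (s j - s k)))]
    · rw [Finset.prod_mul_distrib, Finset.prod_mul_distrib, Finset.prod_const, hcard5]
      ring
    · intro k hk
      have hkj := Finset.ne_of_mem_erase hk
      have hki := Finset.ne_of_mem_erase (Finset.mem_of_mem_erase hk)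
      have h1 := ha j hj
      have h2 := ha k (Finset.mem_of_mem_erase hk)
      rw [if_neg (by simp [hkj, hki]), hdet]
      simp only [a, s] at h1 h2 ⊢
      field_simp
      ring
  have hπ : ∏ k ∈ N.erase j, (s j - s k) ≠ 0 := by
    refine Finset.prod_ne_zero_iff.2 fun k hk => sub_ne_zero.2 fun h => ?_
    exact Finset.ne_of_mem_erase hk (hs hj (Finset.mem_of_mem_erase hk) h).symm
  have haj := ha j hj
  have hv := (hne _ (hti hji)).2
  have hv' : lin3 v (p (t j)) = a j * s j := (mul_div_cancel₀ _ haj).symm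
  have hsj : s j ≠ 0 := div_ne_zero hv haj
  have e1 : secantProd p (t i) (t j) = K / (a j * (a j * s j)) := by
    rw [eq_div_iff (mul_ne_zero haj (mul_ne_zero haj hsj)), ← hv']
    exact hprod _ (hti hji)
  have e2 : secantProd (p ∘ t) i j =
      -(c ^ 5 * a j ^ 4 * (∏ k ∈ N, a k) * ∏ k ∈ N.erase j, (s j - s k)) :=
    mul_right_cancel₀ haj (by rw [hprod2]; ring)
  have hP : P.eval (s j) = s j * (lin3 v x - lin3 u x * s j) * (lin3 v y - lin3 u y * s j) := by
    simp [P]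
  rw [e1, e2, hP, hdet, hdet, hv']
  change _ * (c * (a j * _ - _)) * (c * (a j * _ - _)) = _
  generalize ∏ k ∈ N.erase j, (s j - s k) = π at hπ ⊢
  generalize ∏ k ∈ N, a k = U at hU ⊢
  field_simp

end TangentForms

/-- No nonzero quadratic form vanishes at all six of the vectors `p b`; equivalently, their squares
are linearly independent in the symmetric square. -/
def SquaresIndependent {F : Type*} [Field F] (p : Fin 6 → Fin 3 → F) : Prop :=
  ∀ μ : Fin 6 → F, (∀ k l, ∑ b, μ b * (p b k * p b l) = 0) → μ = 0

section Conics

variable {F : Type*} [Field F]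

lemma sum_mul_lin3_mul_lin3 {β : Type*} [Fintype β] (p : β → Fin 3 → F) (μ : β → F)
    (φ ψ : Fin 3 → F) : ∑ b, μ b * (lin3 φ (p b) * lin3 ψ (p b)) =
      ∑ k, ∑ l, φ k * ψ l * ∑ b, μ b * (p b k * p b l) := by
  simp only [Fin.sum_univ_three, Finset.mul_sum, ← Finset.sum_add_distrib]
  refine Finset.sum_congr rfl fun b _ => ?_
  simp only [lin3]
  ring

lemma lin3_mul_lin3_of_eq_sum {β : Type*} [Fintype β] {p : β → Fin 3 → F} {μ : β → F}
    {x : Fin 3 → F} (h : ∀ k l, x k * x l = ∑ b, μ b * (p b k * p b l)) (φ ψ : Fin 3 → F) :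
    lin3 φ x * lin3 ψ x = ∑ b, μ b * (lin3 φ (p b) * lin3 ψ (p b)) := by
  rw [sum_mul_lin3_mul_lin3]
  simp only [← h, Fin.sum_univ_three, lin3]
  ring

lemma SquaresIndependent.exists_eq_sum {p : Fin 6 → Fin 3 → F} (hp : SquaresIndependent p)
    (x : Fin 3 → F) : ∃ ρ : Fin 6 → F, ∀ k l, x k * x l = ∑ b, ρ b * (p b k * p b l) := by
  let ver : (Fin 3 → F) → Fin 6 → F := fun y =>
    ![y 0 * y 0, y 1 * y 1, y 2 * y 2, y 1 * y 2, y 0 * y 2, y 0 * y 1]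
  have entries : ∀ (y : Fin 3 → F) (μ : Fin 6 → F), ver y = ∑ b, μ b • ver (p b) →
      ∀ k l, y k * y l = ∑ b, μ b * (p b k * p b l) := by
    intro y μ h k l
    have h0 := congrFun h 0
    have h1 := congrFun h 1
    have h2 := congrFun h 2
    have h3 := congrFun h 3
    have h4 := congrFun h 4
    have h5 := congrFun h 5
    simp [ver, Finset.sum_apply] at h0 h1 h2 h3 h4 h5
    fin_cases k <;> fin_cases l <;> simp <;> first
      | assumption
      | (simp only [mul_comm (y 1) (y 0), mul_comm (y 2) (y 0), mul_comm (y 2) (y 1),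
          mul_comm (p _ 1) (p _ 0), mul_comm (p _ 2) (p _ 0), mul_comm (p _ 2) (p _ 1)]
         assumption)
  have hli : LinearIndependent F (ver ∘ p) := by
    rw [Fintype.linearIndependent_iff]
    intro μ h
    refine congrFun (hp μ fun k l => ?_)
    have h' := entries 0 μ (by
      rw [show ver 0 = 0 by ext i; fin_cases i <;> simp [ver]]; exact h.symm) k l
    simpa using h'.symm
  have hspan := hli.span_eq_top_of_card_eq_finrank' (by simp)
  have hx : ver x ∈ Submodule.span F (Set.range (ver ∘ p)) := hspan ▸ Submodule.mem_top
  obtain ⟨ρ, hρ⟩ := (Submodule.mem_span_range_iff_exists_fun F).1 hx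
  exact ⟨ρ, entries x ρ hρ.symm⟩

lemma squaresIndependent_of_bracket {p : Fin 6 → Fin 3 → F} (hp : IsArc p)
    (h : det3 (p 0) (p 1) (p 4) * det3 (p 2) (p 3) (p 4) *
        (det3 (p 0) (p 2) (p 5) * det3 (p 1) (p 3) (p 5)) ≠
      det3 (p 0) (p 1) (p 5) * det3 (p 2) (p 3) (p 5) *
        (det3 (p 0) (p 2) (p 4) * det3 (p 1) (p 3) (p 4))) : SquaresIndependent p := by
  intro μ hμ
  have key : ∀ a b c d, ∑ i, μ i * (det3 a b (p i) * det3 c d (p i)) = 0 := by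
    intro a b c d
    have := sum_mul_lin3_mul_lin3 p μ (cross3 a b) (cross3 c d)
    simp only [hμ, mul_zero, Finset.sum_const_zero, lin3_cross3] at this
    exact this
  have e1 := key (p 0) (p 1) (p 2) (p 3)
  have e2 := key (p 0) (p 2) (p 1) (p 3)
  simp only [Fin.sum_univ_six, det3_self_right, det3_self_outer, mul_zero, zero_mul, zero_add,
    add_zero] at e1 e2
  have h4 : μ 4 = 0 := by
    refine (mul_eq_zero.1 (?_ : μ 4 * _ = 0)).resolve_right (sub_ne_zero.2 h)
    linear_combination (det3 (p 0) (p 2) (p 5) * det3 (p 1) (p 3) (p 5)) * e1 -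
      (det3 (p 0) (p 1) (p 5) * det3 (p 2) (p 3) (p 5)) * e2
  have h5 : μ 5 = 0 := by
    refine (mul_eq_zero.1 (?_ : μ 5 * _ = 0)).resolve_right (sub_ne_zero.2 h)
    linear_combination -(det3 (p 0) (p 2) (p 4) * det3 (p 1) (p 3) (p 4)) * e1 +
      (det3 (p 0) (p 1) (p 4) * det3 (p 2) (p 3) (p 4)) * e2
  have f0 := key (p 1) (p 2) (p 1) (p 3)
  have f1 := key (p 0) (p 2) (p 0) (p 3)
  have f2 := key (p 0) (p 1) (p 0) (p 3)
  have f3 := key (p 0) (p 1) (p 0) (p 2)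
  simp only [Fin.sum_univ_six, det3_self_right, det3_self_outer, mul_zero, zero_mul, zero_add,
    add_zero, h4, h5, mul_eq_zero] at f0 f1 f2 f3
  have n := fun i j k hij hik hjk => hp i j k hij hik hjk
  funext i
  fin_cases i
  · exact f0.resolve_right (not_or.2 ⟨n _ _ _ (by decide) (by decide) (by decide),
      n _ _ _ (by decide) (by decide) (by decide)⟩)
  · exact f1.resolve_right (not_or.2 ⟨n _ _ _ (by decide) (by decide) (by decide),
      n _ _ _ (by decide) (by decide) (by decide)⟩)
  · exact f2.resolve_right (not_or.2 ⟨n _ _ _ (by decide) (by decide) (by decide),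
      n _ _ _ (by decide) (by decide) (by decide)⟩)
  · exact f3.resolve_right (not_or.2 ⟨n _ _ _ (by decide) (by decide) (by decide),
      n _ _ _ (by decide) (by decide) (by decide)⟩)
  · exact h4
  · exact h5

/-- If the squares of the `b i` are independent, the determinants `det3 (b i) (b j) m` and
`det3 (b i) (b j) n` cannot be related by a rank-one factor. -/
lemma SquaresIndependent.not_det3_eq {b : Fin 6 → Fin 3 → F} (hb : SquaresIndependent b)
    {m n : Fin 3 → F} (hbmn : ∀ i, det3 (b i) m n ≠ 0)
    (hbn : ∀ i j, i ≠ j → det3 (b i) (b j) n ≠ 0) {σ : F} (hσ : σ ≠ 0) {θ : Fin 6 → F}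
    (hθ : ∀ i, θ i ≠ 0) :
    ¬ ∀ i j, i ≠ j → det3 (b i) (b j) m = σ * (θ i * θ j) * det3 (b i) (b j) n := by
  intro h
  let z : Fin 3 → F := cross3 m n
  have hz : ∀ x, lin3 z x = det3 x m n := fun x => by rw [lin3_cross3, det3_rotate]
  let τ : Fin 6 → F := fun i => det3 (b i) m n / θ i
  have hτ : ∀ i, det3 (b i) m n = θ i * τ i := fun i => (mul_div_cancel₀ _ (hθ i)).symm
  have h' : ∀ i j, det3 (b i) (b j) m = σ * (θ i * θ j) * det3 (b i) (b j) n := by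
    intro i j
    by_cases hij : i = j
    · subst hij; simp [det3_self_left]
    · exact h i j hij
  have hlin : ∀ i, det3 (b i) (b 0) n * τ 1 + det3 (b 0) (b 1) n * τ i +
      det3 (b 1) (b i) n * τ 0 = 0 := by
    intro i
    have hpl : det3 (b i) (b 0) m * det3 (b 1) m n + det3 (b 0) (b 1) m * det3 (b i) m n +
        det3 (b 1) (b i) m * det3 (b 0) m n = 0 := by
      simp only [det3]; ring
    rw [h', h', h', hτ, hτ, hτ] at hpl
    refine (mul_eq_zero.1 (?_ : (σ * (θ i * θ 0 * θ 1)) * _ = 0)).resolve_left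
      (mul_ne_zero hσ (mul_ne_zero (mul_ne_zero (hθ i) (hθ 0)) (hθ 1)))
    linear_combination hpl
  let δ := det3 (b 0) (b 1) n
  have hδ : δ ≠ 0 := hbn 0 1 (by decide)
  let ℓ : Fin 3 → F := fun k => (cross3 (b 1) n k * τ 0 - cross3 (b 0) n k * τ 1) / δ
  have hℓ : ∀ x, lin3 ℓ x * δ = -(det3 x (b 0) n * τ 1 + det3 (b 1) x n * τ 0) := by
    intro x
    simp only [ℓ, lin3]
    field_simp
    simp [cross3, det3]; ring
  have hℓb : ∀ i, lin3 ℓ (b i) = τ i := by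
    intro i
    refine mul_right_cancel₀ hδ ?_
    rw [hℓ]
    linear_combination -hlin i
  obtain ⟨ρ, hρ⟩ := hb.exists_eq_sum (b 0 + m)
  have hvan : ∀ i, lin3 (cross3 (b 0) m) (b i) * lin3 ℓ (b i) * τ 0 -
      σ * det3 (b 0) m n * (lin3 z (b i) * lin3 (cross3 (b 0) n) (b i)) = 0 := by
    intro i
    have := h' i 0
    rw [hℓb, hz, hτ, hτ, lin3_cross3, lin3_cross3]
    have e1 : det3 (b 0) m (b i) = det3 (b i) (b 0) m := det3_rotate _ _ _
    have e2 : det3 (b 0) n (b i) = det3 (b i) (b 0) n := det3_rotate _ _ _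
    rw [e1, e2, this]; ring
  have hQ : lin3 (cross3 (b 0) m) (b 0 + m) * lin3 ℓ (b 0 + m) * τ 0 -
      σ * det3 (b 0) m n * (lin3 z (b 0 + m) * lin3 (cross3 (b 0) n) (b 0 + m)) = 0 := by
    rw [lin3_mul_lin3_of_eq_sum hρ, lin3_mul_lin3_of_eq_sum hρ, Finset.sum_mul, Finset.mul_sum,
      ← Finset.sum_sub_distrib]
    refine Finset.sum_eq_zero fun i _ => ?_
    linear_combination ρ i * hvan i
  have e1 : lin3 (cross3 (b 0) m) (b 0 + m) = 0 := by
    rw [lin3_cross3, det3_add_right, det3_self_outer, det3_self_right, add_zero]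
  have e2 : lin3 z (b 0 + m) = det3 (b 0) m n := by rw [hz]; simp [det3]; ring
  have e3 : lin3 (cross3 (b 0) n) (b 0 + m) = -det3 (b 0) m n := by
    rw [lin3_cross3]; simp [det3]; ring
  rw [e1, e2, e3] at hQ
  have h0 := hbmn 0
  refine mul_ne_zero hσ (mul_ne_zero h0 (mul_ne_zero h0 h0)) ?_
  linear_combination hQ

end Conics

section Weights

variable {F : Type*} [Field F]

/-- A symmetric matrix of weights satisfying the Lagrange identities on seven vectors, six of which
do not lie on a conic, has rank one off the diagonal. -/
lemma weight_eq_of_squaresIndependent (h2 : (2 : F) ≠ 0) {p : Option (Fin 6) → Fin 3 → F}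
    (hp : IsArc p) (hb : SquaresIndependent fun i => p (some i))
    {w : Option (Fin 6) → Option (Fin 6) → F} (hsymm : ∀ i j, i ≠ j → w i j = w j i)
    (hw : ∀ i j, i ≠ j → w i j ≠ 0)
    (hsum : ∀ i x y, ∑ j, w i j * det3 (p i) (p j) x * det3 (p i) (p j) y = 0) :
    ∃ K, ∀ i j : Fin 6, i ≠ j →
      w (some i) (some j) = K * (w (some i) none * w (some j) none) := by
  have hp0 : ∀ i, p i ≠ 0 := by
    intro i h0
    obtain ⟨j, k, hij, hik, hjk⟩ : ∃ j k : Option (Fin 6), i ≠ j ∧ i ≠ k ∧ j ≠ k := by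
      clear h0; revert i; decide
    exact hp i j k hij hik hjk (by rw [h0]; simp [det3])
  obtain ⟨ρ, hρ⟩ := hb.exists_eq_sum (p none)
  -- the linear dependencies between squares produced by antisymmetry
  have hdep : ∀ m, ∃ μ : Option (Fin 6) → F, μ m = 0 ∧
      (∀ i k, ∑ j, w i j * det3 (p i) (p j) (p m) * p j k = μ i * p i k) ∧
      ∀ k l, ∑ i, μ i * (p i k * p i l) = 0 := by
    intro m
    have hL : ∀ i, ∃ c : F, (fun k => ∑ j, w i j * det3 (p i) (p j) (p m) * p j k) = c • p i := by
      intro i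
      refine exists_eq_smul_of_det3_eq_zero (hp0 i) fun y => ?_
      rw [← hsum i (p m) y]
      simp only [det3, Finset.sum_mul, Finset.mul_sum, ← Finset.sum_sub_distrib,
        ← Finset.sum_add_distrib]
      exact Finset.sum_congr rfl fun j _ => by ring
    choose μ hμ using hL
    have hμ' : ∀ i k, ∑ j, w i j * det3 (p i) (p j) (p m) * p j k = μ i * p i k :=
      fun i k => congrFun (hμ i) k
    refine ⟨μ, ?_, hμ', ?_⟩
    · obtain ⟨k, hk⟩ := Function.ne_iff.1 (hp0 m)
      have := hμ' m k
      simp only [det3_self_outer, mul_zero, zero_mul, Finset.sum_const_zero] at this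
      exact (mul_eq_zero.1 this.symm).resolve_right hk
    · intro k l
      have e1 : ∑ i, μ i * (p i k * p i l) =
          ∑ i, ∑ j, w i j * det3 (p i) (p j) (p m) * p j k * p i l := by
        refine Finset.sum_congr rfl fun i _ => ?_
        rw [← mul_assoc, ← hμ', Finset.sum_mul]
      have e2 : ∑ i, μ i * (p i k * p i l) =
          -∑ i, ∑ j, w i j * det3 (p i) (p j) (p m) * p j k * p i l := by
        rw [Finset.sum_comm, ← Finset.sum_neg_distrib]
        refine Finset.sum_congr rfl fun i _ => ?_
        rw [mul_comm (p i k), ← mul_assoc, ← hμ', Finset.sum_mul, ← Finset.sum_neg_distrib]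
        refine Finset.sum_congr rfl fun j _ => ?_
        by_cases hij : i = j
        · subst hij; simp [det3_self_left]
        · rw [hsymm i j hij, det3_swap (p j) (p i)]; ring
      have e3 : 2 * ∑ i, μ i * (p i k * p i l) = 0 := by linear_combination e1 + e2
      exact (mul_eq_zero.1 e3).resolve_left h2
  have hindep : ∀ μ : Option (Fin 6) → F, (∀ k l, ∑ i, μ i * (p i k * p i l) = 0) →
      ∀ i, μ (some i) + μ none * ρ i = 0 := by
    intro μ h
    refine congrFun (hb (fun i => μ (some i) + μ none * ρ i) fun k l => ?_)
    rw [← h k l, Fintype.sum_option, hρ, Finset.mul_sum, ← Finset.sum_add_distrib]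
    exact Finset.sum_congr rfl fun i _ => by ring
  have hρ2 : ∀ i j, i ≠ j → ρ i = 0 → ρ j ≠ 0 := by
    intro i j hij hi hj
    obtain ⟨a, b, c, d, hab, hcd, hall⟩ : ∃ a b c d : Fin 6, a ≠ b ∧ c ≠ d ∧
        ∀ e, e = i ∨ e = j ∨ e = a ∨ e = b ∨ e = c ∨ e = d := by
      clear hi hj
      revert i j
      decide
    have h := lin3_mul_lin3_of_eq_sum hρ (cross3 (p (some a)) (p (some b)))
      (cross3 (p (some c)) (p (some d)))
    rw [Finset.sum_eq_zero] at h
    · simp only [lin3_cross3] at h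
      exact mul_ne_zero (hp _ _ _ (by simpa using hab) (by simp) (by simp))
        (hp _ _ _ (by simpa using hcd) (by simp) (by simp)) h
    · intro e _
      simp only [lin3_cross3]
      rcases hall e with rfl | rfl | rfl | rfl | rfl | rfl <;>
        simp [hi, hj, det3_self_outer, det3_self_right]
  have hzero : ∀ (m i : Option (Fin 6)) (_ : ∀ c, m = some c → ρ c ≠ 0) (k : Fin 3),
      ∑ j, w i j * det3 (p i) (p j) (p m) * p j k = 0 := by
    intro m i hm k
    obtain ⟨μ, hμm, hμ, hμ0⟩ := hdep m
    have h := hindep μ hμ0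
    have hn : μ none = 0 := by
      rcases m with _ | c
      · exact hμm
      · have hc := h c
        rw [hμm, zero_add] at hc
        exact (mul_eq_zero.1 hc).resolve_right (hm c rfl)
    have : μ i = 0 := by
      rcases i with _ | i
      · exact hn
      · simpa [hn] using h i
    rw [hμ, this, zero_mul]
  have hrel : ∀ i c : Fin 6, c ≠ i → w (some i) (some c) + w (some i) none * ρ c = 0 := by
    intro i c hci
    obtain ⟨a, hai, ha⟩ : ∃ a, a ≠ i ∧ ρ a ≠ 0 := by
      obtain ⟨a, b, hai, hbi, hab⟩ : ∃ a b : Fin 6, a ≠ i ∧ b ≠ i ∧ a ≠ b := by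
        clear hci; revert i; decide
      by_cases ha : ρ a = 0
      · exact ⟨b, hbi, hρ2 a b hab ha⟩
      · exact ⟨a, hai, ha⟩
    let M : Fin 3 → Fin 3 → F := fun k l =>
      ∑ j, (if j = some i then 0 else w (some i) j) * (p j k * p j l)
    have hM : ∀ m, (∀ c, m = some c → ρ c ≠ 0) → ∀ k,
        det3 (p (some i)) (M k) (p m) = 0 := by
      intro m hm k
      rw [← hzero m (some i) hm k]
      simp only [M, det3, Finset.sum_mul, Finset.mul_sum, ← Finset.sum_sub_distrib,
        ← Finset.sum_add_distrib]
      refine Finset.sum_congr rfl fun j _ => ?_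
      split_ifs with hj
      · subst hj; ring
      · ring
    have hM1 := hM none (by simp)
    have hM2 := hM (some a) (by simpa using ha)
    have hdet : det3 (p (some i)) (p (some a)) (p none) ≠ 0 :=
      hp _ _ _ (by simpa using hai.symm) (by simp) (by simp)
    have hrow : ∀ k, ∃ q : F, M k = q • p (some i) := by
      intro k
      refine exists_eq_smul_of_det3_eq_zero (hp0 _) fun y => ?_
      have hid : det3 (p (some i)) (M k) y * det3 (p (some i)) (p (some a)) (p none) =
          det3 (p (some i)) (M k) (p (some a)) * det3 (p (some i)) y (p none) +
          det3 (p (some i)) (M k) (p none) * det3 (p (some i)) (p (some a)) y := by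
        simp only [det3]; ring
      rw [hM1, hM2, zero_mul, zero_mul, add_zero] at hid
      exact (mul_eq_zero.1 hid).resolve_right hdet
    choose q hq using hrow
    have hMs : ∀ k l, M k l = M l k := fun k l =>
      Finset.sum_congr rfl fun j _ => by rw [mul_comm (p j k)]
    have hq' : ∀ k l, M k l = q k * p (some i) l := fun k l => congrFun (hq k) l
    obtain ⟨ν, hν⟩ : ∃ ν : F, q = ν • p (some i) := by
      refine exists_eq_smul_of_det3_eq_zero (hp0 _) fun y => ?_
      have h01 := hMs 0 1
      have h02 := hMs 0 2
      have h12 := hMs 1 2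
      rw [hq', hq'] at h01 h02 h12
      simp only [det3]
      linear_combination y 2 * (-h01) + y 1 * h02 - y 0 * h12
    have hfin := hindep (fun j => if j = some i then -ν else w (some i) j) (by
      intro k l
      have e : ∑ j, (if j = some i then -ν else w (some i) j) * (p j k * p j l) =
          M k l + ∑ j, if j = some i then -ν * (p j k * p j l) else 0 := by
        rw [← Finset.sum_add_distrib]
        refine Finset.sum_congr rfl fun j _ => ?_
        split_ifs <;> ring
      rw [e, hq', hν, Finset.sum_ite_eq' Finset.univ (some i), if_pos (Finset.mem_univ _)]
      simp only [Pi.smul_apply, smul_eq_mul]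
      ring) c
    simpa [hci] using hfin
  have hρ0 : ∀ c, ρ c ≠ 0 := by
    intro c hc
    obtain ⟨i, hi⟩ : ∃ i : Fin 6, c ≠ i := by clear hc; revert c; decide
    have := hrel i c hi
    rw [hc, mul_zero, add_zero] at this
    exact hw _ _ (by simpa using hi.symm) this
  refine ⟨-(ρ 0 / w (some 0) none), fun i j hij => ?_⟩
  have hw0 : ∀ i : Fin 6, w (some i) none ≠ 0 := fun i => hw _ _ (by simp)
  have hratio : w (some j) none * ρ 0 = ρ j * w (some 0) none := by
    by_cases hj : j = 0
    · subst hj; ring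
    · have h1 := hrel j 0 (Ne.symm hj)
      have h2 := hrel 0 j hj
      rw [hsymm _ _ (by simpa using hj)] at h1
      linear_combination h1 - h2
  have h3 := hrel i j hij.symm
  have := hw0 0
  field_simp
  linear_combination (w (some 0) none) * h3 + w (some i) none * hratio

end Weights

section LargeArcs

variable {F : Type*} [Field F] [Fintype F] {ι : Type*} [Fintype ι] [DecidableEq ι]

lemma HasTangentForms.exists_secantProd_mul_det3 {p : ι → Fin 3 → F} (hp : HasTangentForms p)
    (hodd : Odd (Fintype.card F)) (hcard : Fintype.card ι = Fintype.card F) {b : Fin 6 → ι}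
    (hb : Function.Injective b) (hind : SquaresIndependent (p ∘ b)) {m : ι} (hm : ∀ i, b i ≠ m) :
    ∃ (K : F) (ω : Fin 6 → F), K ≠ 0 ∧ (∀ i, ω i ≠ 0) ∧ ∀ i j, i ≠ j →
      secantProd p (b i) (b j) * secantProd (p ∘ b) i j * det3 (p (b i)) (p (b j)) (p m) *
        (K * (ω i * ω j)) = 1 := by
  have harc := hp.isArc hodd hcard
  let t : Option (Fin 6) → ι := fun o => o.elim m b
  have ht : Function.Injective t := by
    intro i j hij
    rcases i with _ | i <;> rcases j with _ | j
    · rfl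
    · exact absurd hij.symm (hm j)
    · exact absurd hij (hm i)
    · exact congrArg some (hb hij)
  have harc' : IsArc (p ∘ t) := fun i j k hij hik hjk =>
    harc _ _ _ (ht.ne hij) (ht.ne hik) (ht.ne hjk)
  have hw : ∀ i j, i ≠ j → (secantProd p (t i) (t j))⁻¹ * (secantProd (p ∘ t) i j)⁻¹ ≠ 0 :=
    fun i j hij => mul_ne_zero (inv_ne_zero (secantProd_ne_zero harc (ht.ne hij)))
      (inv_ne_zero (secantProd_ne_zero harc' hij))
  obtain ⟨K, hK⟩ := weight_eq_of_squaresIndependent (two_ne_zero_of_odd_card hodd) harc' hind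
    (w := fun i j => (secantProd p (t i) (t j))⁻¹ * (secantProd (p ∘ t) i j)⁻¹)
    (fun i j hij => by
      rw [secantProd_swap (hcard ▸ hodd) p (ht.ne hij),
        secantProd_swap (by decide) (p ∘ t) hij, inv_neg, inv_neg, neg_mul_neg])
    hw (hp.sum_eq_zero hodd hcard (by simp) t ht)
  refine ⟨K, fun i => (secantProd p (b i) m)⁻¹ * (secantProd (p ∘ t) (some i) none)⁻¹, ?_,
    fun i => hw (some i) none (by simp), fun i j hij => ?_⟩
  · rintro rfl
    exact hw (some 0) (some 1) (by simp) (by simpa using hK 0 1 (by decide))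
  · have hij' : some i ≠ some j := by simpa using hij
    have h := hK i j hij
    have e : secantProd (p ∘ t) (some i) (some j) =
        det3 (p (b i)) (p (b j)) (p m) * secantProd (p ∘ b) i j := by
      simp [secantProd, Fintype.prod_option, t]
    have h1 := secantProd_ne_zero harc (hb.ne hij)
    have h2 := secantProd_ne_zero harc' hij'
    change _ * (K * (((secantProd p (t (some i)) (t none))⁻¹ * _) *
      ((secantProd p (t (some j)) (t none))⁻¹ * _))) = 1
    rw [← h, mul_assoc (secantProd p (b i) (b j)), mul_comm (secantProd (p ∘ b) i j), ← e]
    change secantProd p (b i) (b j) * secantProd (p ∘ t) (some i) (some j) *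
      ((secantProd p (b i) (b j))⁻¹ * _) = 1
    field_simp

/-- **Segre's theorem** for `q`-arcs, local form: any six points of an arc with `q ≥ 8` points lie
on a conic. -/
lemma HasTangentForms.not_squaresIndependent {p : ι → Fin 3 → F} (hp : HasTangentForms p)
    (hodd : Odd (Fintype.card F)) (hcard : Fintype.card ι = Fintype.card F)
    (h8 : 8 ≤ Fintype.card ι) {b : Fin 6 → ι} (hb : Function.Injective b) :
    ¬ SquaresIndependent (p ∘ b) := by
  intro hind
  have harc := hp.isArc hodd hcard
  obtain ⟨m, hm, n, hn, hmn⟩ : ∃ m ∈ (Finset.univ.image b)ᶜ, ∃ n ∈ (Finset.univ.image b)ᶜ,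
      m ≠ n := by
    refine Finset.one_lt_card.1 ?_
    rw [Finset.card_compl, Finset.card_image_of_injective _ hb, Finset.card_univ,
      Fintype.card_fin]
    omega
  replace hm : ∀ i, b i ≠ m := by simpa using hm
  replace hn : ∀ i, b i ≠ n := by simpa using hn
  obtain ⟨K, ω, hK, hω, h⟩ := hp.exists_secantProd_mul_det3 hodd hcard hb hind hm
  obtain ⟨L, υ, hL, hυ, h'⟩ := hp.exists_secantProd_mul_det3 hodd hcard hb hind hn
  refine hind.not_det3_eq (m := p m) (n := p n) (σ := L / K) (θ := fun i => υ i / ω i)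
    (fun i => harc _ _ _ (hm i) (hn i) hmn)
    (fun i j hij => harc _ _ _ (hb.ne hij) (hn i) (hn j)) (div_ne_zero hL hK)
    (fun i => div_ne_zero (hυ i) (hω i)) fun i j hij => ?_
  have e := h i j hij
  have e' := h' i j hij
  have h1 := hω i
  have h2 := hω j
  have h3 : secantProd p (b i) (b j) * secantProd (p ∘ b) i j ≠ 0 := by
    intro h0; rw [h0] at e; simp at e
  simp only [Function.comp_apply]
  field_simp
  refine mul_left_cancel₀ h3 ?_
  linear_combination e - e'

end LargeArcs

section Lines

variable {F : Type*} [Field F]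

lemma exists_pgLine_mem_iff {φ : Fin 3 → F} (hφ : φ ≠ 0) :
    ∃ ℓ : PGLine F, ∀ x, x ∈ ℓ.1 ↔ lin3 φ x = 0 := by
  let f : Module.Dual F (Fin 3 → F) :=
    { toFun := lin3 φ, map_add' := lin3_add φ, map_smul' := fun c x => lin3_smul φ c x }
  have hf : f ≠ 0 := by
    rintro h
    refine hφ (funext fun k => ?_)
    have := LinearMap.congr_fun h (Pi.single k 1)
    fin_cases k <;> simpa [f, lin3] using this
  have h := Module.Dual.finrank_ker_add_one_of_ne_zero hf
  rw [Module.finrank_fin_fun] at h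
  exact ⟨⟨LinearMap.ker f, by omega⟩, fun x => LinearMap.mem_ker⟩

lemma PGLine.exists_mem_iff (ℓ : PGLine F) : ∃ φ : Fin 3 → F, ∀ x, x ∈ ℓ.1 ↔ lin3 φ x = 0 := by
  have hlt : ℓ.1 < ⊤ := by
    refine lt_top_iff_ne_top.2 fun h => ?_
    have := ℓ.2
    rw [h, finrank_top, Module.finrank_fin_fun] at this
    omega
  obtain ⟨f, hf, hle⟩ := Submodule.exists_le_ker_of_lt_top _ hlt
  have hfk := Module.Dual.finrank_ker_add_one_of_ne_zero hf
  rw [Module.finrank_fin_fun] at hfk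
  have heq := Submodule.eq_of_le_of_finrank_eq hle (by rw [ℓ.2]; omega)
  refine ⟨fun k => f (Pi.single k 1), fun x => ?_⟩
  rw [heq, LinearMap.mem_ker, LinearMap.pi_apply_eq_sum_univ f x]
  simp only [Fin.sum_univ_three, lin3, smul_eq_mul]
  have hs : ∀ k : Fin 3, (fun j => if k = j then (1 : F) else 0) = Pi.single k 1 := by
    intro k; ext j; simp [Pi.single_apply, eq_comm]
  simp only [hs, mul_comm]

lemma PGLine.eq_of_le {ℓ m : PGLine F} (h : ℓ.1 ≤ m.1) : ℓ = m :=
  Subtype.ext (Submodule.eq_of_le_of_finrank_eq h (by rw [ℓ.2, m.2]))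

lemma pgMem_iff (P : PGPoint F) (ℓ : PGLine F) : PGMem P ℓ ↔ P.rep ∈ ℓ.1 := by
  rw [PGMem, Projectivization.submodule_eq, Submodule.span_singleton_le_iff_mem]

lemma IsTwoSemiarc.hasTangentForms {S : Set (PGPoint F)} (hS : IsTwoSemiarc S) :
    HasTangentForms fun P : S => P.1.rep := by
  rintro ⟨P, hP⟩
  refine ⟨P.rep_nonzero, ?_⟩
  obtain ⟨ℓ, m, hℓm, hT⟩ := Set.ncard_eq_two.1 (hS.2 P hP)
  have hℓ : PGTangent S ℓ P := by
    have : ℓ ∈ {ℓ | PGTangent S ℓ P} := by rw [hT]; simp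
    exact this
  have hm : PGTangent S m P := by
    have : m ∈ {ℓ | PGTangent S ℓ P} := by rw [hT]; simp
    exact this
  obtain ⟨u, hu⟩ := ℓ.exists_mem_iff
  obtain ⟨v, hv⟩ := m.exists_mem_iff
  have htan : ∀ {n : PGLine F}, PGTangent S n P → P.rep ∈ n.1 ∧ ∀ Q ∈ S, Q ≠ P → Q.rep ∉ n.1 := by
    intro n hn
    have hmem : ∀ Q, Q ∈ S ∩ {x | PGMem x n} ↔ Q = P := fun Q => by
      rw [show S ∩ {x | PGMem x n} = {P} from hn, Set.mem_singleton_iff]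
    exact ⟨(pgMem_iff _ _).1 ((hmem P).2 rfl).2,
      fun Q hQ hQP hQn => hQP ((hmem Q).1 ⟨hQ, (pgMem_iff _ _).2 hQn⟩)⟩
  refine ⟨u, v, (hu _).1 (htan hℓ).1, (hv _).1 (htan hm).1, ?_, ?_⟩
  · rintro ⟨Q, hQ⟩ hQP
    have hQP' : Q ≠ P := fun h => hQP (Subtype.ext h)
    exact ⟨fun h => (htan hℓ).2 Q hQ hQP' ((hu _).2 h),
      fun h => (htan hm).2 Q hQ hQP' ((hv _).2 h)⟩
  · intro s hs
    have hlin : ∀ x, lin3 (fun k => v k - s * u k) x = lin3 v x - s * lin3 u x := by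
      intro x; simp only [lin3]; ring
    obtain ⟨n, hn⟩ := exists_pgLine_mem_iff (φ := fun k => v k - s * u k) (by
      intro h0
      refine hℓm (PGLine.eq_of_le fun x hx => ?_)
      have := hlin x
      rw [h0, (hu x).1 hx] at this
      rw [hv]
      simpa [lin3] using this.symm)
    have hnℓ : n ≠ ℓ := by
      rintro rfl
      refine hℓm (PGLine.eq_of_le fun x hx => ?_)
      have h1 := (hn x).1 hx
      rw [hlin, (hu x).1 hx] at h1
      rw [hv]
      simpa using h1
    have hnm : n ≠ m := by
      rintro rfl
      refine hℓm (PGLine.eq_of_le fun x hx => ?_).symm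
      have h1 := (hn x).1 hx
      rw [hlin, (hv x).1 hx] at h1
      rw [hu]
      simpa [hs] using h1
    have hnt : ¬ PGTangent S n P := by
      intro h
      have : n ∈ ({ℓ, m} : Set (PGLine F)) := hT ▸ h
      simp [hnℓ, hnm] at this
    have hPn : P.rep ∈ n.1 := by
      rw [hn, hlin, (hu _).1 (htan hℓ).1, (hv _).1 (htan hm).1]; ring
    by_contra! hno
    refine hnt (Set.eq_singleton_iff_unique_mem.2 ⟨⟨hP, (pgMem_iff _ _).2 hPn⟩, ?_⟩)
    rintro Q ⟨hQ, hQn⟩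
    by_contra hQP
    refine hno ⟨Q, hQ⟩ (fun h => hQP (congrArg Subtype.val h)) ?_
    have := (hn _).1 ((pgMem_iff _ _).1 hQn)
    rw [hlin] at this
    linear_combination this

end Lines

/-- The quadratic Cremona map `(x, y, z) ↦ (yz, xz, xy)`. -/
def cremona {F : Type*} [Field F] (x : Fin 3 → F) : Fin 3 → F := ![x 1 * x 2, x 0 * x 2, x 0 * x 1]

/-- Coordinates, up to a common factor, with respect to the vectors `a`, `b`, `c`. -/
def frameCoord {F : Type*} [Field F] (a b c x : Fin 3 → F) : Fin 3 → F :=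
  ![det3 x b c, det3 a x c, det3 a b x]

set_option maxRecDepth 100000 in
set_option synthInstance.maxHeartbeats 2000000 in
set_option maxHeartbeats 2000000 in
set_option synthInstance.maxSize 10000 in
/-- In `PG(2,7)`, if a seventh point extends six points of an arc, three of which form the
coordinate triangle and a fourth is the unit point, to an arc, then the six points are on a
conic. -/
lemma zmod_seven_cremona_or_collinear : ∀ x y : ZMod 7, x ≠ 0 → x ≠ 1 → y ≠ 0 → y ≠ 1 → x ≠ y →
    ∀ x' : ZMod 7, x' ≠ 0 → x' ≠ 1 → x' ≠ x → ∀ y' : ZMod 7, y' ≠ 0 → y' ≠ 1 → x' ≠ y' → y' ≠ y →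
    x * y' ≠ x' * y → (x - 1) * (y' - 1) ≠ (x' - 1) * (y - 1) →
    x * x' * (y' - y) - y * y' * (x' - x) + (y * x' - x * y') = 0 ∨
    ∀ x'' : ZMod 7, x'' ≠ 0 → x'' ≠ 1 → x'' ≠ x → x'' ≠ x' →
    ∀ y'' : ZMod 7, y'' ≠ 0 → y'' ≠ 1 → x'' ≠ y'' → y'' ≠ y → y'' ≠ y' →
    x * y'' ≠ x'' * y → (x - 1) * (y'' - 1) ≠ (x'' - 1) * (y - 1) →
    x' * y'' ≠ x'' * y' → (x' - 1) * (y'' - 1) ≠ (x'' - 1) * (y' - 1) →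
    x * (y' - y'') - y * (x' - x'') + (x' * y'' - x'' * y') = 0 := by
  decide

section FrameCoordinates

variable {F : Type*} [Field F]

lemma det3_frameCoord (a b c x y z : Fin 3 → F) :
    det3 (frameCoord a b c x) (frameCoord a b c y) (frameCoord a b c z) =
      det3 a b c ^ 2 * det3 x y z := by
  simp [det3, frameCoord]; ring

lemma frameCoord_left (a b c : Fin 3 → F) : frameCoord a b c a = ![det3 a b c, 0, 0] := by
  simp [frameCoord, det3_self_left, det3_self_outer]

lemma frameCoord_middle (a b c : Fin 3 → F) : frameCoord a b c b = ![0, det3 a b c, 0] := by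
  simp [frameCoord, det3_self_left, det3_self_right]

lemma frameCoord_right (a b c : Fin 3 → F) : frameCoord a b c c = ![0, 0, det3 a b c] := by
  simp [frameCoord, det3_self_outer, det3_self_right]

lemma eq_zero_of_frameCoord_eq_zero {a b c x : Fin 3 → F} (h : det3 a b c ≠ 0)
    (hx : frameCoord a b c x = 0) : x = 0 := by
  have h0 : det3 x b c = 0 := congrFun hx 0
  have h1 : det3 a x c = 0 := congrFun hx 1
  have h2 : det3 a b x = 0 := congrFun hx 2
  ext k
  refine (mul_eq_zero.1 (?_ : det3 a b c * x k = 0)).resolve_left h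
  have : det3 a b c * x k = det3 x b c * a k + det3 a x c * b k + det3 a b x * c k := by
    fin_cases k <;> simp [det3] <;> ring
  rw [this, h0, h1, h2]; ring

/-- If a Pascal-type bracket identity holds for six vectors, they are on a conic, that is, the
Cremona images of three of them in the frame formed by the others are dependent. -/
lemma det3_cremona_of_bracket {a b c x y z : Fin 3 → F} (h : det3 a b c ≠ 0)
    (hxyz : det3 a b y * det3 c x y * (det3 a c z * det3 b x z) =
      det3 a b z * det3 c x z * (det3 a c y * det3 b x y)) :
    det3 (cremona (frameCoord a b c x)) (cremona (frameCoord a b c y))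
      (cremona (frameCoord a b c z)) = 0 := by
  have e : ∀ u v w, det3 (frameCoord a b c u) (frameCoord a b c v) (frameCoord a b c w) =
      det3 a b c ^ 2 * det3 u v w := det3_frameCoord a b c
  have key : (det3 a b c ^ 2 * det3 a b y) * (det3 a b c ^ 2 * det3 c x y) *
      ((det3 a b c ^ 2 * det3 a c z) * (det3 a b c ^ 2 * det3 b x z)) =
      (det3 a b c ^ 2 * det3 a b z) * (det3 a b c ^ 2 * det3 c x z) *
      ((det3 a b c ^ 2 * det3 a c y) * (det3 a b c ^ 2 * det3 b x y)) := by
    linear_combination (det3 a b c ^ 2) ^ 4 * hxyz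
  simp only [← e, frameCoord_left, frameCoord_middle, frameCoord_right] at key
  generalize frameCoord a b c x = X at *
  generalize frameCoord a b c y = Y at *
  generalize frameCoord a b c z = Z at *
  generalize det3 a b c = d at *
  refine (mul_eq_zero.1 (?_ : d ^ 8 * _ = 0)).resolve_left (pow_ne_zero _ h)
  simp only [det3, cremona, Matrix.cons_val] at key ⊢
  linear_combination d ^ 2 * key

/-- In the plane over a field with seven elements, any six points of a `7`-arc are on a conic. -/
lemma det3_cremona_of_card_eq_seven [Fintype F] (hF : Fintype.card F = 7)
    {u : Fin 4 → Fin 3 → F} (h0 : ∀ i k, u i k ≠ 0)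
    (h01 : ∀ i j, i ≠ j → u i 0 * u j 1 ≠ u j 0 * u i 1)
    (h02 : ∀ i j, i ≠ j → u i 0 * u j 2 ≠ u j 0 * u i 2)
    (h12 : ∀ i j, i ≠ j → u i 1 * u j 2 ≠ u j 1 * u i 2) (hu : IsArc u) :
    det3 (cremona (u 0)) (cremona (u 1)) (cremona (u 2)) = 0 := by
  have : Fact (Nat.Prime 7) := ⟨by norm_num⟩
  let e : ZMod 7 ≃+* F := ZMod.ringEquivOfPrime F (by norm_num) hF
  let x : Fin 4 → F := fun i => u i 0 * u 0 2 / (u 0 0 * u i 2)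
  let y : Fin 4 → F := fun i => u i 1 * u 0 2 / (u 0 1 * u i 2)
  let A := u 0 0 / u 0 2
  let B := u 0 1 / u 0 2
  have hx0 : x 0 = 1 := by simp only [x]; field_simp [h0]
  have hy0 : y 0 = 1 := by simp only [y]; field_simp [h0]
  have hx : ∀ i, u i 0 = x i * (A * u i 2) := fun i => by
    have := h0 0 0; have := h0 0 2; have := h0 i 2
    simp only [x, A]; field_simp
  have hy : ∀ i, u i 1 = y i * (B * u i 2) := fun i => by
    have := h0 0 1; have := h0 0 2; have := h0 i 2
    simp only [y, B]; field_simp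
  clear_value x y A B
  have xne : ∀ i, x i ≠ 0 := fun i h => h0 i 0 (by rw [hx, h, zero_mul])
  have yne : ∀ i, y i ≠ 0 := fun i h => h0 i 1 (by rw [hy, h, zero_mul])
  have xx : ∀ i j, i ≠ j → x i ≠ x j := fun i j hij h => h02 i j hij (by rw [hx i, hx j, h]; ring)
  have yy : ∀ i j, i ≠ j → y i ≠ y j := fun i j hij h => h12 i j hij (by rw [hy i, hy j, h]; ring)
  have xy : ∀ i j, i ≠ j → x i * y j ≠ x j * y i := fun i j hij h => h01 i j hij (by
    rw [hx i, hx j, hy i, hy j]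
    linear_combination (A * u i 2) * (B * u j 2) * h)
  have col : ∀ i j k, i ≠ j → i ≠ k → j ≠ k →
      x i * (y j - y k) - y i * (x j - x k) + (x j * y k - x k * y j) ≠ 0 :=
    fun i j k hij hik hjk h => hu i j k hij hik hjk (by
      simp only [det3]
      rw [hx i, hx j, hx k, hy i, hy j, hy k]
      linear_combination A * B * (u i 2 * u j 2 * u k 2) * h)
  have hsymm : ∀ {s t : F}, s ≠ t → e.symm s ≠ e.symm t := fun h => e.symm.injective.ne h
  have ne0 : ∀ {s : F}, s ≠ 0 → e.symm s ≠ 0 := fun h => by simpa using h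
  have ne1 : ∀ {s : F}, s ≠ 1 → e.symm s ≠ 1 := fun h => by simpa using h
  have mulne : ∀ {s t s' t' : F}, s * t ≠ s' * t' →
      e.symm s * e.symm t ≠ e.symm s' * e.symm t' := fun h => by
    rw [← map_mul, ← map_mul]; exact hsymm h
  have colne : ∀ i j, i ≠ 0 → j ≠ 0 → i ≠ j →
      (e.symm (x i) - 1) * (e.symm (y j) - 1) ≠ (e.symm (x j) - 1) * (e.symm (y i) - 1) := by
    intro i j hi hj hij
    have := col 0 i j hi.symm hj.symm hij
    rw [← map_one e.symm, ← map_sub, ← map_sub, ← map_sub, ← map_sub]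
    refine mulne fun h => this ?_
    rw [hx0, hy0]
    linear_combination h
  have x1 : ∀ i, i ≠ 0 → x i ≠ 1 := fun i hi => hx0 ▸ xx i 0 hi
  have y1 : ∀ i, i ≠ 0 → y i ≠ 1 := fun i hi => hy0 ▸ yy i 0 hi
  have xney : ∀ i, i ≠ 0 → x i ≠ y i := fun i hi h => xy i 0 hi (by rw [hx0, hy0, h]; ring)
  have d10 : (1 : Fin 4) ≠ 0 := by decide
  have d20 : (2 : Fin 4) ≠ 0 := by decide
  have d30 : (3 : Fin 4) ≠ 0 := by decide
  have d12 : (1 : Fin 4) ≠ 2 := by decide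
  have d13 : (1 : Fin 4) ≠ 3 := by decide
  have d23 : (2 : Fin 4) ≠ 3 := by decide
  rcases zmod_seven_cremona_or_collinear (e.symm (x 1)) (e.symm (y 1))
    (ne0 (xne 1)) (ne1 (x1 1 d10)) (ne0 (yne 1)) (ne1 (y1 1 d10)) (hsymm (xney 1 d10))
    (e.symm (x 2)) (ne0 (xne 2)) (ne1 (x1 2 d20)) (hsymm (xx 2 1 d12.symm))
    (e.symm (y 2)) (ne0 (yne 2)) (ne1 (y1 2 d20)) (hsymm (xney 2 d20)) (hsymm (yy 2 1 d12.symm))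
    (mulne (xy 1 2 d12)) (colne 1 2 d10 d20 d12) with h | h
  · replace h := congrArg e h
    simp only [map_add, map_sub, map_mul, map_zero, RingEquiv.apply_symm_apply] at h
    simp only [det3, cremona, Matrix.cons_val]
    rw [hx 0, hx 1, hx 2, hy 0, hy 1, hy 2, hx0, hy0]
    linear_combination (A * B * (u 0 2 * u 1 2 * u 2 2)) ^ 2 * h
  · replace h := congrArg e (h (e.symm (x 3)) (ne0 (xne 3)) (ne1 (x1 3 d30))
      (hsymm (xx 3 1 d13.symm)) (hsymm (xx 3 2 d23.symm))
      (e.symm (y 3)) (ne0 (yne 3)) (ne1 (y1 3 d30)) (hsymm (xney 3 d30)) (hsymm (yy 3 1 d13.symm))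
      (hsymm (yy 3 2 d23.symm)) (mulne (xy 1 3 d13)) (colne 1 3 d10 d30 d13)
      (mulne (xy 2 3 d23)) (colne 2 3 d20 d30 d23))
    simp only [map_add, map_sub, map_mul, map_zero, RingEquiv.apply_symm_apply] at h
    exact absurd h (col 1 2 3 d12 d13 d23)

lemma exists_linearEquiv_of_forall_eq_zero {f : (Fin 3 → F) → Fin 3 → F}
    (hadd : ∀ x y, f (x + y) = f x + f y) (hsmul : ∀ (c : F) x, f (c • x) = c • f x)
    (h0 : ∀ x, f x = 0 → x = 0) : ∃ σ : (Fin 3 → F) ≃ₗ[F] (Fin 3 → F), ∀ x, σ x = f x := by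
  let L : (Fin 3 → F) →ₗ[F] (Fin 3 → F) := { toFun := f, map_add' := hadd, map_smul' := hsmul }
  have hL : Function.Injective L := (injective_iff_map_eq_zero L).2 h0
  exact ⟨LinearEquiv.ofInjectiveEndo L hL, fun x => rfl⟩

end FrameCoordinates

section NormalForm

variable {F : Type*} [Field F] [Fintype F] {ι : Type*} [Fintype ι] [DecidableEq ι]

/-- Any six points of a `q`-arc with tangent forms, `q` odd, lie on a conic. -/
lemma HasTangentForms.det3_cremona_eq_zero {p : ι → Fin 3 → F} (hp : HasTangentForms p)
    (hodd : Odd (Fintype.card F)) (hcard : Fintype.card ι = Fintype.card F) {b : Fin 6 → ι}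
    (hb : Function.Injective b) :
    det3 (cremona (frameCoord (p (b 0)) (p (b 1)) (p (b 2)) (p (b 3))))
      (cremona (frameCoord (p (b 0)) (p (b 1)) (p (b 2)) (p (b 4))))
      (cremona (frameCoord (p (b 0)) (p (b 1)) (p (b 2)) (p (b 5)))) = 0 := by
  have harc := hp.isArc hodd hcard
  have hb6 : 6 ≤ Fintype.card ι := by simpa using Fintype.card_le_of_injective b hb
  have hδ : det3 (p (b 0)) (p (b 1)) (p (b 2)) ≠ 0 :=
    harc _ _ _ (hb.ne (by decide)) (hb.ne (by decide)) (hb.ne (by decide))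
  rcases Nat.lt_or_ge (Fintype.card ι) 8 with h8 | h8
  · have h7 : Fintype.card F = 7 := by
      rw [← hcard] at hodd ⊢
      obtain ⟨k, hk⟩ := hodd
      omega
    obtain ⟨m, hm⟩ : ∃ m, m ∉ Finset.univ.image b := by
      by_contra! h
      have := Finset.card_le_card (fun x _ => h x : (Finset.univ : Finset ι) ⊆ _)
      rw [Finset.card_image_of_injective _ hb] at this
      simp at this
      omega
    replace hm : ∀ i, b i ≠ m := by simpa using hm
    let t : Fin 4 → ι := ![b 3, b 4, b 5, m]
    have ht : Function.Injective t := by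
      intro i j hij
      have h34 := hb.ne (show (3 : Fin 6) ≠ 4 by decide)
      have h35 := hb.ne (show (3 : Fin 6) ≠ 5 by decide)
      have h45 := hb.ne (show (4 : Fin 6) ≠ 5 by decide)
      have h3 := hm 3
      have h4 := hm 4
      have h5 := hm 5
      fin_cases i <;> fin_cases j <;> simp [t] at hij ⊢ <;> first
        | exact absurd hij ‹_›
        | exact absurd hij.symm ‹_›
    have htb : ∀ i k, (k = 0 ∨ k = 1 ∨ k = 2) → t i ≠ b k := by
      intro i k hk
      have h3 := hm k
      rcases hk with rfl | rfl | rfl <;> fin_cases i <;> simp [t, hb.eq_iff, h3.symm]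
    let r : ι → Fin 3 → F := fun i => frameCoord (p (b 0)) (p (b 1)) (p (b 2)) (p i)
    have hr : IsArc r := fun i j k hij hik hjk => by
      simp only [r, det3_frameCoord]
      exact mul_ne_zero (pow_ne_zero _ hδ) (harc i j k hij hik hjk)
    have r0 : r (b 0) = ![det3 (p (b 0)) (p (b 1)) (p (b 2)), 0, 0] := frameCoord_left _ _ _
    have r1 : r (b 1) = ![0, det3 (p (b 0)) (p (b 1)) (p (b 2)), 0] := frameCoord_middle _ _ _
    have r2 : r (b 2) = ![0, 0, det3 (p (b 0)) (p (b 1)) (p (b 2))] := frameCoord_right _ _ _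
    generalize det3 (p (b 0)) (p (b 1)) (p (b 2)) = d at r0 r1 r2
    have n01 := hb.ne (show (0 : Fin 6) ≠ 1 by decide)
    have n02 := hb.ne (show (0 : Fin 6) ≠ 2 by decide)
    have n12 := hb.ne (show (1 : Fin 6) ≠ 2 by decide)
    have c0 : ∀ i, t i ≠ b 0 := fun i => htb i 0 (by decide)
    have c1 : ∀ i, t i ≠ b 1 := fun i => htb i 1 (by decide)
    have c2 : ∀ i, t i ≠ b 2 := fun i => htb i 2 (by decide)
    refine det3_cremona_of_card_eq_seven h7 (u := fun i => r (t i)) ?_ ?_ ?_ ?_ ?_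
    · intro i k h
      fin_cases k
      · refine hr _ _ _ (c1 i) (c2 i) n12 ?_
        simp at h
        simp [r1, r2, det3, h]
      · refine hr _ _ _ (c0 i) (c2 i) n02 ?_
        simp at h
        simp [r0, r2, det3, h]
      · refine hr _ _ _ (c0 i) (c1 i) n01 ?_
        simp at h
        simp [r0, r1, det3, h]
    · intro i j hij h
      refine hr _ _ _ (ht.ne hij) (c2 i) (c2 j) ?_
      simp only [r2, det3, Matrix.cons_val]
      linear_combination d * h
    · intro i j hij h
      refine hr _ _ _ (ht.ne hij) (c1 i) (c1 j) ?_
      simp only [r1, det3, Matrix.cons_val]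
      linear_combination -d * h
    · intro i j hij h
      refine hr _ _ _ (ht.ne hij) (c0 i) (c0 j) ?_
      simp only [r0, det3, Matrix.cons_val]
      linear_combination d * h
    · exact fun i j k hij hik hjk => hr _ _ _ (ht.ne hij) (ht.ne hik) (ht.ne hjk)
  · have hns := hp.not_squaresIndependent hodd hcard h8 hb
    refine det3_cremona_of_bracket hδ (by_contra fun h => hns ?_)
    exact squaresIndependent_of_bracket
      (fun i j k hij hik hjk => harc _ _ _ (hb.ne hij) (hb.ne hik) (hb.ne hjk)) h

lemma HasTangentForms.exists_lin3_cremona_eq_zero {p : ι → Fin 3 → F} (hp : HasTangentForms p)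
    (hodd : Odd (Fintype.card F)) (hcard : Fintype.card ι = Fintype.card F) {a b c : ι}
    (hab : a ≠ b) (hac : a ≠ c) (hbc : b ≠ c) :
    ∃ φ : Fin 3 → F, (∀ k, φ k ≠ 0) ∧
      ∀ i, lin3 φ (cremona (frameCoord (p a) (p b) (p c) (p i))) = 0 := by
  have harc := hp.isArc hodd hcard
  have hδ := harc a b c hab hac hbc
  let r : ι → Fin 3 → F := fun i => frameCoord (p a) (p b) (p c) (p i)
  have hr : IsArc r := fun i j k hij hik hjk => by
    simp only [r, det3_frameCoord]
    exact mul_ne_zero (pow_ne_zero _ hδ) (harc i j k hij hik hjk)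
  have r0 : r a = ![det3 (p a) (p b) (p c), 0, 0] := frameCoord_left _ _ _
  have r1 : r b = ![0, det3 (p a) (p b) (p c), 0] := frameCoord_middle _ _ _
  have r2 : r c = ![0, 0, det3 (p a) (p b) (p c)] := frameCoord_right _ _ _
  generalize det3 (p a) (p b) (p c) = d at r0 r1 r2
  have hsuff : ∀ φ : Fin 3 → F, (∀ i, i ≠ a → i ≠ b → i ≠ c → lin3 φ (cremona (r i)) = 0) →
      ∀ i, lin3 φ (cremona (r i)) = 0 := by
    intro φ h i
    by_cases ha : i = a
    · subst ha; rw [r0]; simp [lin3, cremona]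
    by_cases hb : i = b
    · subst hb; rw [r1]; simp [lin3, cremona]
    by_cases hc : i = c
    · subst hc; rw [r2]; simp [lin3, cremona]
    exact h i ha hb hc
  rcases Nat.lt_or_ge 1 ({a, b, c} : Finset ι)ᶜ.card with h | h
  · obtain ⟨m, hm, n, hn, hmn⟩ := Finset.one_lt_card.1 h
    simp only [Finset.mem_compl, Finset.mem_insert, Finset.mem_singleton, not_or] at hm hn
    obtain ⟨hma, hmb, hmc⟩ := hm
    obtain ⟨hna, hnb, hnc⟩ := hn
    have hne : ∀ i, i ≠ a → i ≠ b → i ≠ c → ∀ k, r i k ≠ 0 := by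
      intro i ha hb hc k h
      fin_cases k
      · refine hr i b c hb hc hbc ?_
        simp at h
        simp [r1, r2, det3, h]
      · refine hr i a c ha hc hac ?_
        simp at h
        simp [r0, r2, det3, h]
      · refine hr i a b ha hb hab ?_
        simp at h
        simp [r0, r1, det3, h]
    have xm := hne m hma hmb hmc
    have xn := hne n hna hnb hnc
    refine ⟨cross3 (cremona (r m)) (cremona (r n)), fun k => ?_, hsuff _ fun i ha hb hc => ?_⟩
    · fin_cases k
      · have := mul_ne_zero (mul_ne_zero (xm 0) (xn 0)) (hr m n a hmn hma hna)
        refine fun h => this ?_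
        simp only [r0, det3, Matrix.cons_val, cross3, cremona, Fin.zero_eta] at h ⊢
        linear_combination -d * h
      · have := mul_ne_zero (mul_ne_zero (xm 1) (xn 1)) (hr m n b hmn hmb hnb)
        refine fun h => this ?_
        simp only [r1, det3, Matrix.cons_val, cross3, cremona, Fin.mk_one] at h ⊢
        linear_combination -d * h
      · have := mul_ne_zero (mul_ne_zero (xm 2) (xn 2)) (hr m n c hmn hmc hnc)
        refine fun h => this ?_
        simp only [r2, det3, Matrix.cons_val, cross3, cremona, Fin.reduceFinMk] at h ⊢
        linear_combination -d * h
    · rw [lin3_cross3]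
      by_cases him : i = m
      · rw [him, det3_self_outer]
      by_cases hin : i = n
      · rw [hin, det3_self_right]
      have hinj : Function.Injective ![a, b, c, m, n, i] := by
        rw [← List.nodup_ofFn]
        simp [List.ofFn_succ, hab, hac, hbc, Ne.symm hma, Ne.symm hmb, Ne.symm hmc, Ne.symm hna,
          Ne.symm hnb, Ne.symm hnc, Ne.symm ha, Ne.symm hb, Ne.symm hc, hmn, Ne.symm him,
          Ne.symm hin]
      have h := hp.det3_cremona_eq_zero hodd hcard hinj
      simp only [Matrix.cons_val] at h
      exact h
  · have hc3 : ({a, b, c} : Finset ι).card = 3 :=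
      Finset.card_eq_three.2 ⟨a, b, c, hab, hac, hbc, rfl⟩
    have h0 : ({a, b, c} : Finset ι)ᶜ = ∅ := by
      rw [← Finset.card_eq_zero]
      have := Finset.card_add_card_compl ({a, b, c} : Finset ι)
      rw [hcard, hc3] at this
      obtain ⟨k, hk⟩ := hodd
      omega
    refine ⟨fun _ => 1, fun _ => one_ne_zero, hsuff _ fun i ha hb hc => ?_⟩
    have : i ∈ ({a, b, c} : Finset ι)ᶜ := by simp [ha, hb, hc]
    simp [h0] at this

lemma HasTangentForms.exists_linearEquiv_mem_conic {p : ι → Fin 3 → F} (hp : HasTangentForms p)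
    (hodd : Odd (Fintype.card F)) (hcard : Fintype.card ι = Fintype.card F) :
    ∃ σ : (Fin 3 → F) ≃ₗ[F] (Fin 3 → F), ∀ i, σ (p i) 0 * σ (p i) 2 = σ (p i) 1 ^ 2 := by
  have h3 : 2 < (Finset.univ : Finset ι).card := by
    rw [Finset.card_univ, hcard]
    have := Fintype.one_lt_card (α := F)
    obtain ⟨k, hk⟩ := hodd
    omega
  obtain ⟨a, -, b, -, c, -, hab, hac, hbc⟩ := Finset.two_lt_card.1 h3
  obtain ⟨φ, hφ, h⟩ := hp.exists_lin3_cremona_eq_zero hodd hcard hab hac hbc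
  have hδ := hp.isArc hodd hcard a b c hab hac hbc
  let g : (Fin 3 → F) → Fin 3 → F := frameCoord (p a) (p b) (p c)
  have gadd : ∀ x y, g (x + y) = g x + g y := by
    intro x y; ext k
    fin_cases k <;> simp [g, frameCoord, det3] <;> ring
  have gsmul : ∀ (s : F) x, g (s • x) = s • g x := by
    intro s x; ext k
    fin_cases k <;> simp [g, frameCoord, det3] <;> ring
  obtain ⟨σ, hσ⟩ := exists_linearEquiv_of_forall_eq_zero
    (f := fun x => ![g x 0 / φ 0 + g x 1 / φ 1, g x 1 / φ 1, g x 2 / φ 2 + g x 1 / φ 1])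
    (by intro x y; ext k; simp only [gadd]; fin_cases k <;> simp <;> ring)
    (by intro s x; ext k; simp only [gsmul]; fin_cases k <;> simp <;> ring)
    (by
      intro x hx
      have e0 : g x 0 / φ 0 + g x 1 / φ 1 = 0 := congrFun hx 0
      have e1 : g x 1 / φ 1 = 0 := congrFun hx 1
      have e2 : g x 2 / φ 2 + g x 1 / φ 1 = 0 := congrFun hx 2
      refine eq_zero_of_frameCoord_eq_zero hδ (funext fun k => ?_)
      change g x k = 0
      rw [e1, add_zero] at e0 e2
      fin_cases k
      · simpa [hφ 0] using e0
      · simpa [hφ 1] using e1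
      · simpa [hφ 2] using e2)
  refine ⟨σ, fun i => ?_⟩
  have h0 := hφ 0
  have h1 := hφ 1
  have h2 := hφ 2
  have hi := h i
  simp only [lin3, cremona, Matrix.cons_val] at hi
  change φ 0 * (g (p i) 1 * g (p i) 2) + φ 1 * (g (p i) 0 * g (p i) 2) +
    φ 2 * (g (p i) 0 * g (p i) 1) = 0 at hi
  simp only [hσ, Matrix.cons_val]
  field_simp
  linear_combination φ 1 * hi

/-- A `q`-arc with tangent forms, `q` odd, is projectively equivalent to the affine part of the
conic `xz = y²`. -/
lemma HasTangentForms.exists_linearEquiv_mem_affine_conic {p : ι → Fin 3 → F}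
    (hp : HasTangentForms p) (hodd : Odd (Fintype.card F))
    (hcard : Fintype.card ι = Fintype.card F) :
    ∃ σ : (Fin 3 → F) ≃ₗ[F] (Fin 3 → F), ∀ i, σ (p i) 0 ≠ 0 ∧
      σ (p i) 0 * σ (p i) 2 = σ (p i) 1 ^ 2 := by
  classical
  obtain ⟨σ, hσ⟩ := hp.exists_linearEquiv_mem_conic hodd hcard
  let f : ι → Option F := fun i =>
    if σ (p i) 0 = 0 then none else some (σ (p i) 1 / σ (p i) 0)
  have hf : ¬ Function.Surjective f := by
    intro h
    have := Fintype.card_le_of_surjective f h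
    rw [Fintype.card_option] at this
    omega
  obtain ⟨o, ho⟩ := not_forall.1 hf
  replace ho : ∀ i, f i ≠ o := not_exists.1 ho
  rcases o with _ | a
  · exact ⟨σ, fun i => ⟨fun h => ho i (by simp [f, h]), hσ i⟩⟩
  · obtain ⟨τ, hτ⟩ := exists_linearEquiv_of_forall_eq_zero
      (f := fun x : Fin 3 → F => ![x 2 - 2 * a * x 1 + a ^ 2 * x 0, x 1 - a * x 0, x 0])
      (by intro x y; ext k; fin_cases k <;> simp <;> ring)
      (by intro s x; ext k; fin_cases k <;> simp <;> ring)
      (by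
        intro x hx
        have e0 : x 2 - 2 * a * x 1 + a ^ 2 * x 0 = 0 := congrFun hx 0
        have e1 : x 1 - a * x 0 = 0 := congrFun hx 1
        have e2 : x 0 = 0 := congrFun hx 2
        ext k
        fin_cases k
        · exact e2
        · simpa [e2] using e1
        · simp [e2] at e1
          simpa [e1, e2] using e0)
    refine ⟨σ.trans τ, fun i => ?_⟩
    simp only [LinearEquiv.trans_apply, hτ, Matrix.cons_val]
    have hi := hσ i
    refine ⟨fun h => ?_, by linear_combination hi⟩
    have h1 : σ (p i) 1 - a * σ (p i) 0 = 0 := by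
      refine pow_eq_zero_iff two_ne_zero |>.1 ?_
      linear_combination σ (p i) 0 * h - hi
    by_cases h0 : σ (p i) 0 = 0
    · refine (hp i).1 ((LinearEquiv.map_eq_zero_iff σ).1 (funext fun k => ?_))
      rw [h0, mul_zero, sub_zero] at h1
      rw [h0, h1] at h
      fin_cases k
      · exact h0
      · exact h1
      · simpa using h
    · refine ho i ?_
      simp only [f, h0, if_false, Option.some.injEq]
      rw [div_eq_iff h0]
      linear_combination h1

end NormalForm

/-- The affine part of the conic `xz = y²`. -/
def affineConic (F : Type*) [Field F] : Set (PGPoint F) :=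
  {P | P.rep 0 ≠ 0 ∧ P.rep 0 * P.rep 2 = P.rep 1 ^ 2}

section Uniqueness

variable {F : Type*} [Field F]

lemma mk_mem_affineConic {v : Fin 3 → F} (hv : v ≠ 0) (h0 : v 0 ≠ 0) (h : v 0 * v 2 = v 1 ^ 2) :
    Projectivization.mk F v hv ∈ affineConic F := by
  obtain ⟨a, ha⟩ := Projectivization.exists_smul_eq_mk_rep F v hv
  have e : ∀ k, (Projectivization.mk F v hv).rep k = a * v k := fun k => by
    rw [← ha]; rfl
  refine ⟨by rw [e]; exact mul_ne_zero a.ne_zero h0, ?_⟩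
  rw [e, e, e]
  linear_combination (a : F) ^ 2 * h

lemma ncard_affineConic_le [Fintype F] : (affineConic F).ncard ≤ Fintype.card F := by
  rw [← Nat.card_eq_fintype_card, ← Set.ncard_univ]
  refine Set.ncard_le_ncard_of_injOn (fun P : PGPoint F => P.rep 1 / P.rep 0)
    (fun _ _ => Set.mem_univ _) ?_
  rintro P ⟨hP0, hP⟩ Q ⟨hQ0, hQ⟩ h
  simp only at h
  rw [div_eq_div_iff hP0 hQ0] at h
  rw [← P.mk_rep, ← Q.mk_rep, Projectivization.mk_eq_mk_iff']
  refine ⟨P.rep 0 / Q.rep 0, funext fun k => ?_⟩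
  simp only [Pi.smul_apply, smul_eq_mul]
  rw [div_mul_eq_mul_div, div_eq_iff hQ0]
  fin_cases k
  · rfl
  · simp; linear_combination -h
  · simp
    refine mul_left_cancel₀ (mul_ne_zero hP0 hQ0) ?_
    linear_combination P.rep 0 ^ 2 * hQ - Q.rep 0 ^ 2 * hP -
      (P.rep 1 * Q.rep 0 + Q.rep 1 * P.rep 0) * h

lemma IsTwoSemiarc.exists_image_eq_affineConic [Fintype F] {S : Set (PGPoint F)}
    (hS : IsTwoSemiarc S) (hodd : Odd (Fintype.card F)) (hcard : S.ncard = Fintype.card F) :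
    ∃ σ : (Fin 3 → F) ≃ₗ[F] (Fin 3 → F),
      Projectivization.map σ.toLinearMap σ.injective '' S = affineConic F := by
  classical
  have : Finite S := Set.finite_of_ncard_pos (by rw [hcard]; exact Fintype.card_pos)
  have := Fintype.ofFinite S
  have hc : Fintype.card S = Fintype.card F := by
    rw [← hcard, ← Nat.card_coe_set_eq, Nat.card_eq_fintype_card]
  obtain ⟨σ, hσ⟩ := hS.hasTangentForms.exists_linearEquiv_mem_affine_conic hodd hc
  refine ⟨σ, Set.eq_of_subset_of_ncard_le ?_ ?_ ?_⟩
  · rintro _ ⟨P, hP, rfl⟩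
    obtain ⟨h0, h⟩ := hσ ⟨P, hP⟩
    rw [← P.mk_rep, Projectivization.map_mk]
    exact mk_mem_affineConic _ h0 h
  · rw [Set.ncard_image_of_injective _ (Projectivization.map_injective _ σ.injective), hcard]
    exact ncard_affineConic_le
  · have : Finite (PGPoint F) := inferInstance
    exact Set.toFinite _

end Uniqueness

/-- In `PG(2,q)`, `q` odd, any two 2-semiarcs of size `q` are projectively equivalent. -/
theorem two_semiarc_size_q_unique (F : Type*) [Field F] [Fintype F] (q : ℕ)
    (hcard : Fintype.card F = q) (hodd : Odd q)
    (S S' : Set (PGPoint F))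
    (hS : IsTwoSemiarc S) (hSq : S.ncard = q)
    (hS' : IsTwoSemiarc S') (hS'q : S'.ncard = q) :
    ∃ σ : (Fin 3 → F) ≃ₗ[F] (Fin 3 → F),
      Projectivization.map σ.toLinearMap σ.injective '' S = S' := by
  subst hcard
  obtain ⟨σ, hσ⟩ := hS.exists_image_eq_affineConic hodd hSq
  obtain ⟨τ, hτ⟩ := hS'.exists_image_eq_affineConic hodd hS'q
  refine ⟨σ.trans τ.symm, ?_⟩
  have hinv : ∀ P, Projectivization.map (σ.trans τ.symm).toLinearMap (σ.trans τ.symm).injective P =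
      Projectivization.map τ.symm.toLinearMap τ.symm.injective
        (Projectivization.map σ.toLinearMap σ.injective P) := by
    intro P
    induction P with | h v hv => rfl
  have hinv' : ∀ P, Projectivization.map τ.symm.toLinearMap τ.symm.injective
      (Projectivization.map τ.toLinearMap τ.injective P) = P := by
    intro P
    induction P with | h v hv => simp [Projectivization.map_mk]
  rw [Set.image_congr fun P _ => hinv P, ← Set.image_image, hσ, ← hτ, Set.image_image,
    Set.image_congr fun P _ => hinv' P, Set.image_id']
end
end

section
/- Let S be a 2-semiarc of size 9 in PG(2,5). Then S is projectively equivalent to the projective triangle: there exists a linear automorphism σ of GF(5)³ whose induced map on the projectivization maps the set T = {(1:0:0), (0:1:0), (0:0:1), (1:1:0), (4:1:0), (1:0:1), (4:0:1), (0:1:1), (0:4:1)} onto S. -/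
noncomputable section

instance : Fact (Nat.Prime 5) := ⟨by norm_num⟩

/-- The projective triangle in `PG(2,5)`. -/
def projTriangle : Set (PGPoint (ZMod 5)) :=
  {Projectivization.mk (ZMod 5) ![1, 0, 0] (by decide),
   Projectivization.mk (ZMod 5) ![0, 1, 0] (by decide),
   Projectivization.mk (ZMod 5) ![0, 0, 1] (by decide),
   Projectivization.mk (ZMod 5) ![1, 1, 0] (by decide),
   Projectivization.mk (ZMod 5) ![4, 1, 0] (by decide),
   Projectivization.mk (ZMod 5) ![1, 0, 1] (by decide),
   Projectivization.mk (ZMod 5) ![4, 0, 1] (by decide),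
   Projectivization.mk (ZMod 5) ![0, 1, 1] (by decide),
   Projectivization.mk (ZMod 5) ![0, 4, 1] (by decide)}

/-- Homogeneous coordinates of the `i`-th point of `PG(2,5)`, for `i < 31`, in lexicographic
order of the vectors whose first nonzero coordinate is `1`. -/
def homVec (i : ℕ) : Fin 3 → ZMod 5 :=
  ![if i < 6 then 0 else 1,
    if i < 6 then (if i = 0 then 0 else 1) else ((i - 6) / 5 : ℕ),
    if i = 0 then 1 else ((i - 1) % 5 : ℕ)]

/-- The index of the point of `PG(2,5)` represented by a nonzero vector. -/
def homIndex (v : Fin 3 → ZMod 5) : ℕ :=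
  if v 0 ≠ 0 then 6 + 5 * (v 1 * (v 0 * v 0 * v 0)).val + (v 2 * (v 0 * v 0 * v 0)).val
  else if v 1 ≠ 0 then 1 + (v 2 * (v 1 * v 1 * v 1)).val else 0

lemma homVec_ne_zero (i : ℕ) : homVec i ≠ 0 := by
  intro h
  have h0 := congrFun h 0
  have h1 := congrFun h 1
  have h2 := congrFun h 2
  by_cases hi : i < 6
  · by_cases hz : i = 0 <;> simp [homVec, hi, hz] at h1 h2
  · simp [homVec, hi] at h0

lemma homIndex_lt (v : Fin 3 → ZMod 5) : homIndex v < 31 := by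
  unfold homIndex
  have h (x : ZMod 5) : x.val < 5 := ZMod.val_lt x
  have h1 := h (v 1 * (v 0 * v 0 * v 0))
  have h2 := h (v 2 * (v 0 * v 0 * v 0))
  have h3 := h (v 2 * (v 1 * v 1 * v 1))
  split_ifs <;> omega

lemma homIndex_homVec : ∀ i : Fin 31, homIndex (homVec i) = i := by
  decide +kernel

lemma homIndex_homVec_add_self : ∀ i : Fin 31, homIndex (homVec i + homVec i) = i := by
  decide +kernel

lemma exists_smul_homVec_homIndex (v : Fin 3 → ZMod 5) (hv : v ≠ 0) :
    ∃ c : ZMod 5, c • homVec (homIndex v) = v := by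
  have key : ∀ x y z : ZMod 5, ![x, y, z] ≠ 0 →
      ∃ c : ZMod 5, c • homVec (homIndex ![x, y, z]) = ![x, y, z] := by
    decide +kernel
  have h : ![v 0, v 1, v 2] = v := by
    ext i
    fin_cases i <;> rfl
  simpa only [h] using key (v 0) (v 1) (v 2) (by rwa [h])

/-- The set of points on the line with equation `homVec j ⬝ᵥ x = 0`, as a bit mask. -/
def lineMask (j : Fin 31) : ℕ :=
  Nat.ofBits fun i : Fin 31 => decide (homVec j ⬝ᵥ homVec i = 0)

lemma testBit_lineMask (j i : Fin 31) :
    (lineMask j).testBit i = decide (homVec j ⬝ᵥ homVec i = 0) :=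
  Nat.testBit_ofBits_lt _ _ i.2

/-- Each point of `PG(2,5)` with the six lines through it, as bit masks. -/
def pencils : List (ℕ × List ℕ) :=
  [(1, [1985, 63, 2080374785, 2031617, 65011713, 63489]),
   (2, [69273666, 63, 1108378626, 277094658, 554189314, 138547330]),
   (4, [1090785348, 63, 101195908, 272728580, 137380100, 545393668]),
   (8, [542122056, 63, 84050184, 1082212488, 271062024, 168036872]),
   (16, [302137424, 63, 76550672, 151069712, 539263120, 1078462736]),
   (32, [143163488, 63, 71582752, 570495264, 1075978784, 286263456]),
   (64, [69273666, 1985, 143163488, 542122056, 302137424, 1090785348]),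
   (128, [1985, 138547330, 101195908, 1082212488, 539263120, 286263456]),
   (256, [1985, 277094658, 84050184, 570495264, 137380100, 1078462736]),
   (512, [1985, 554189314, 76550672, 272728580, 1075978784, 168036872]),
   (1024, [1985, 1108378626, 71582752, 151069712, 271062024, 545393668]),
   (2048, [69273666, 63489, 545393668, 1078462736, 168036872, 286263456]),
   (4096, [1090785348, 138547330, 76550672, 570495264, 271062024, 63489]),
   (8192, [542122056, 277094658, 101195908, 151069712, 1075978784, 63489]),
   (16384, [302137424, 554189314, 71582752, 1082212488, 137380100, 63489]),
   (32768, [143163488, 1108378626, 84050184, 272728580, 539263120, 63489]),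
   (65536, [69273666, 2031617, 151069712, 570495264, 272728580, 1082212488]),
   (131072, [302137424, 138547330, 84050184, 2031617, 1075978784, 545393668]),
   (262144, [1090785348, 277094658, 71582752, 2031617, 539263120, 168036872]),
   (524288, [143163488, 554189314, 101195908, 2031617, 271062024, 1078462736]),
   (1048576, [542122056, 1108378626, 76550672, 2031617, 137380100, 286263456]),
   (2097152, [69273666, 65011713, 271062024, 137380100, 1075978784, 539263120]),
   (4194304, [542122056, 138547330, 71582752, 272728580, 65011713, 1078462736]),
   (8388608, [143163488, 277094658, 76550672, 1082212488, 65011713, 545393668]),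
   (16777216, [1090785348, 554189314, 84050184, 151069712, 65011713, 286263456]),
   (33554432, [302137424, 1108378626, 101195908, 570495264, 65011713, 168036872]),
   (67108864, [69273666, 2080374785, 71582752, 84050184, 76550672, 101195908]),
   (134217728, [143163488, 138547330, 2080374785, 151069712, 137380100, 168036872]),
   (268435456, [302137424, 277094658, 2080374785, 272728580, 271062024, 286263456]),
   (536870912, [542122056, 554189314, 2080374785, 570495264, 539263120, 545393668]),
   (1073741824, [1090785348, 1108378626, 2080374785, 1082212488, 1075978784, 1078462736])]

lemma pencils_eq : pencils = (List.finRange 31).map fun i : Fin 31 =>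
    (2 ^ (i : ℕ), ((List.finRange 31).filter fun j : Fin 31 =>
      homVec i ⬝ᵥ homVec j = 0).map lineMask) := by
  decide +kernel

/-- Whether a 2-semiarc may contain all points of `A` and no point of `B`: at each point of `A`,
at least two lines may still be tangents, and at most two certainly are. -/
def admissible (A B : ℕ) : Bool :=
  Nat.beq (Nat.land A B) 0 &&
  pencils.all fun x => Nat.beq (Nat.land A x.1) 0 ||
    (Nat.ble 2 (x.2.countP fun L => Nat.beq (Nat.land A L) x.1) &&
    Nat.ble (x.2.countP fun L =>
      Nat.beq (Nat.land A L) x.1 && Nat.beq (Nat.land L (Nat.lor A B)) L) 2)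

/-- Whether the set of points `A` contains a projective triangle. -/
def containsTriangle (A : ℕ) : Bool :=
  let p : List (Fin 3 → ZMod 5) := ((List.range 31).filter fun i =>
    Nat.beq (Nat.land 1 (Nat.shiftRight A i)) 1).map homVec
  let q : List (Fin 3 → ZMod 5) := p ++ p.map fun v => v + v
  let m (v : Fin 3 → ZMod 5) : Bool := Nat.beq (Nat.land 1 (Nat.shiftRight A (homIndex v))) 1
  p.any fun u => q.any fun v => m (u + v) && m (u - v) && q.any fun w =>
    m (u + w) && m (u - w) && m (v + w) && m (v - w) && decide (Matrix.det ![u, v, w] ≠ 0)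

/-- Checks that every 2-semiarc that contains `A`, is disjoint from `B` and has `a` points of
index less than `k` contains a projective triangle, by deciding its points one by one. -/
def search : ℕ → ℕ → ℕ → ℕ → Bool
  | 0, _, A, B => !admissible A B || containsTriangle A
  | k + 1, a, A, B => !admissible A B ||
      ((Nat.beq a 0 || search k (Nat.pred a) (Nat.lor A (Nat.pow 2 k)) B) &&
       (Nat.ble (Nat.succ k) a || search k a A (Nat.lor B (Nat.pow 2 k))))

lemma search_frame : search 31 9 (2 ^ 0 + 2 ^ 1 + 2 ^ 6 + 2 ^ 12) 0 = true := by decide +kernel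

lemma search_sides : search 31 9 (2 ^ 0 + 2 ^ 1 + 2 ^ 6) 2078208000 = true := by decide +kernel

/-- The mask `s` represents a set of points with exactly two tangents at each point. -/
def IsSemiarcMask (s : ℕ) : Prop :=
  ∀ i : Fin 31, s.testBit i →
    (Finset.univ.filter fun j : Fin 31 => s &&& lineMask j = 2 ^ (i : ℕ)).card = 2

/-- The set of points with mask `s` contains a projective triangle. -/
def HasTriangle (s : ℕ) : Prop :=
  ∃ u v w : Fin 3 → ZMod 5, Matrix.det ![u, v, w] ≠ 0 ∧
    ∀ x ∈ [u, v, w, u + v, u - v, u + w, u - w, v + w, v - w], s.testBit (homIndex x)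

lemma land_two_pow_eq_zero_or (a i : ℕ) : Nat.land a (2 ^ i) = 0 ∨ a.testBit i = true := by
  by_cases h : a.testBit i = true
  · exact Or.inr h
  · refine Or.inl (Nat.eq_of_testBit_eq fun k => ?_)
    change (a &&& 2 ^ i).testBit k = _
    by_cases hk : i = k
    · subst hk
      simp [h]
    · simp [Nat.testBit_two_pow_of_ne hk]

lemma land_one_shiftRight (a i : ℕ) :
    Nat.beq (Nat.land 1 (Nat.shiftRight a i)) 1 = a.testBit i := by
  have h : Nat.land 1 (Nat.shiftRight a i) = (a >>> i) % 2 := Nat.one_and_eq_mod_two _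
  rw [h, Nat.testBit_eq_decide_div_mod_eq, Nat.shiftRight_eq_div_pow, Bool.eq_iff_iff, Nat.beq_eq,
    decide_eq_true_eq]

lemma countP_finRange {n : ℕ} (p : Fin n → Bool) :
    (List.finRange n).countP p = (Finset.univ.filter fun j => p j = true).card := by
  simp [Finset.card, Finset.filter, Fin.univ_def, List.countP_eq_length_filter]

lemma admissible_of_isSemiarcMask {s A B : ℕ} (hs : IsSemiarcMask s)
    (hA : ∀ i, A.testBit i = true → s.testBit i = true)
    (hB : ∀ i, B.testBit i = true → s.testBit i = false) : admissible A B = true := by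
  simp only [admissible, Bool.and_eq_true, Nat.beq_eq, List.all_eq_true, Bool.or_eq_true,
    Nat.ble_eq]
  refine ⟨Nat.eq_of_testBit_eq fun i => ?_, fun x hx => ?_⟩
  · change (A &&& B).testBit i = _
    have h1 := hA i
    have h2 := hB i
    rw [Nat.testBit_and, Nat.zero_testBit]
    grind
  · rw [pencils_eq, List.mem_map] at hx
    obtain ⟨i, -, rfl⟩ := hx
    refine (land_two_pow_eq_zero_or A i).imp_right fun hi => ?_
    have hcard := hs i (hA i hi)
    have hbit {a b c : ℕ} (h : a &&& b = c) (k : ℕ) :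
        (a.testBit k && b.testBit k) = c.testBit k := by rw [← h, Nat.testBit_and]
    simp only [List.countP_map, List.countP_filter, countP_finRange, Function.comp_apply]
    constructor
    · refine hcard.ge.trans (Finset.card_le_card fun j hj => ?_)
      rw [Finset.mem_filter] at hj ⊢
      have hk := hbit hj.2
      have hLi : (lineMask j).testBit i = true := by
        have := hk i
        rw [Nat.testBit_two_pow_self] at this
        grind
      refine ⟨Finset.mem_univ _, ?_⟩
      rw [Bool.and_eq_true, Nat.beq_eq]
      constructor
      · refine Nat.eq_of_testBit_eq fun k => ?_
        change (A &&& lineMask j).testBit k = _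
        rw [Nat.testBit_and]
        by_cases hik : (i : ℕ) = k
        · subst hik
          simp [hi, hLi]
        · have h1 := hk k
          have h2 := hA k
          rw [Nat.testBit_two_pow_of_ne hik] at h1 ⊢
          grind
      · rw [testBit_lineMask] at hLi
        rw [dotProduct_comm]
        simpa using hLi
    · refine (Finset.card_le_card fun j hj => ?_).trans hcard.le
      simp only [Finset.mem_filter, Bool.and_eq_true, Nat.beq_eq] at hj ⊢
      obtain ⟨-, ⟨h1, h2⟩, -⟩ := hj
      refine ⟨Finset.mem_univ _, Nat.eq_of_testBit_eq fun k => ?_⟩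
      have h3 := hbit h1 k
      have h4 : ((lineMask j).testBit k && (A.testBit k || B.testBit k)) =
          (lineMask j).testBit k := by
        rw [← Nat.testBit_or]
        exact hbit h2 k
      have h5 := hA k
      have h6 := hB k
      rw [← h3, Nat.testBit_and]
      grind

lemma hasTriangle_of_containsTriangle {s A : ℕ}
    (hA : ∀ i, A.testBit i = true → s.testBit i = true) (h : containsTriangle A = true) :
    HasTriangle s := by
  simp only [containsTriangle, land_one_shiftRight] at h
  set p : List (Fin 3 → ZMod 5) :=
    ((List.range 31).filter fun i => A.testBit i).map homVec with hp
  set q : List (Fin 3 → ZMod 5) := p ++ p.map fun v => v + v with hq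
  have mem_p {v : Fin 3 → ZMod 5} (hv : v ∈ p) : A.testBit (homIndex v) = true := by
    rw [hp, List.mem_map] at hv
    obtain ⟨i, hi, rfl⟩ := hv
    rw [List.mem_filter, List.mem_range] at hi
    rw [homIndex_homVec ⟨i, hi.1⟩]
    exact hi.2
  have mem_q {v : Fin 3 → ZMod 5} (hv : v ∈ q) : A.testBit (homIndex v) = true := by
    rw [hq, List.mem_append] at hv
    rcases hv with hv | hv
    · exact mem_p hv
    · rw [hp, List.map_map, List.mem_map] at hv
      obtain ⟨i, hi, rfl⟩ := hv
      rw [List.mem_filter, List.mem_range] at hi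
      rw [Function.comp_apply, homIndex_homVec_add_self ⟨i, hi.1⟩]
      exact hi.2
  simp only [List.any_eq_true, Bool.and_eq_true, decide_eq_true_eq] at h
  obtain ⟨u, hu, v, hv, ⟨h1, h2⟩, w, hw, ⟨⟨⟨h3, h4⟩, h5⟩, h6⟩, hdet⟩ := h
  refine ⟨u, v, w, hdet, fun x hx => hA _ ?_⟩
  simp only [List.mem_cons, List.not_mem_nil, or_false] at hx
  rcases hx with rfl | rfl | rfl | rfl | rfl | rfl | rfl | rfl | rfl
  exacts [mem_p hu, mem_q hv, mem_q hw, h1, h2, h3, h4, h5, h6]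

lemma hasTriangle_of_search {s : ℕ} (hs : IsSemiarcMask s) (k a A B : ℕ)
    (hsearch : search k a A B = true)
    (hA : ∀ i, A.testBit i = true → s.testBit i = true)
    (hB : ∀ i, B.testBit i = true → s.testBit i = false)
    (hcount : (List.range k).countP s.testBit = a) : HasTriangle s := by
  have hadm := admissible_of_isSemiarcMask hs hA hB
  induction k generalizing a A B with
  | zero =>
    simp only [search, hadm, Bool.not_true, Bool.false_or] at hsearch
    exact hasTriangle_of_containsTriangle hA hsearch
  | succ k ih =>
    simp only [search, hadm, Bool.not_true, Bool.false_or, Bool.and_eq_true, Bool.or_eq_true,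
      Nat.beq_eq, Nat.ble_eq] at hsearch
    have hor (C i : ℕ) : (Nat.lor C (Nat.pow 2 k)).testBit i = true ↔
        C.testBit i = true ∨ k = i := by
      change (C ||| 2 ^ k).testBit i = true ↔ _
      rw [Nat.testBit_or, Nat.testBit_two_pow, Bool.or_eq_true, decide_eq_true_eq]
    rw [List.range_succ, List.countP_append, List.countP_singleton] at hcount
    by_cases hk : s.testBit k = true
    · rw [if_pos hk] at hcount
      have hA' : ∀ i, (Nat.lor A (Nat.pow 2 k)).testBit i = true → s.testBit i = true := by
        intro i hi
        rcases (hor A i).1 hi with hi | rfl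
        exacts [hA i hi, hk]
      exact ih _ _ _ (hsearch.1.resolve_left (by omega)) hA' hB (by rw [← hcount]; rfl)
        (admissible_of_isSemiarcMask hs hA' hB)
    · rw [if_neg hk, add_zero] at hcount
      have hB' : ∀ i, (Nat.lor B (Nat.pow 2 k)).testBit i = true → s.testBit i = false := by
        intro i hi
        rcases (hor B i).1 hi with hi | rfl
        exacts [hB i hi, Bool.eq_false_iff.2 hk]
      have hle : (List.range k).countP s.testBit ≤ k := by
        simpa using List.countP_le_length (p := s.testBit) (l := List.range k)
      exact ih _ _ _ (hsearch.2.resolve_left (by omega)) hA hB' hcount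
        (admissible_of_isSemiarcMask hs hA hB')

/-- The `i`-th point of `PG(2,5)` in the coordinate system given by `σ`. -/
def coordPoint (σ : (Fin 3 → ZMod 5) ≃ₗ[ZMod 5] (Fin 3 → ZMod 5)) (i : ℕ) : PGPoint (ZMod 5) :=
  Projectivization.mk (ZMod 5) (σ (homVec i)) (σ.map_ne_zero_iff.2 (homVec_ne_zero i))

lemma mk_apply_eq_coordPoint (σ : (Fin 3 → ZMod 5) ≃ₗ[ZMod 5] (Fin 3 → ZMod 5))
    (v : Fin 3 → ZMod 5) (hv : v ≠ 0) (hσ : σ v ≠ 0) :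
    Projectivization.mk (ZMod 5) (σ v) hσ = coordPoint σ (homIndex v) := by
  obtain ⟨c, hc⟩ := exists_smul_homVec_homIndex v hv
  refine (Projectivization.mk_eq_mk_iff' _ _ _ _ _).2 ⟨c, ?_⟩
  rw [← map_smul, hc]

lemma exists_eq_coordPoint (σ : (Fin 3 → ZMod 5) ≃ₗ[ZMod 5] (Fin 3 → ZMod 5))
    (P : PGPoint (ZMod 5)) : ∃ i : Fin 31, P = coordPoint σ i := by
  induction P using Projectivization.ind with
  | h v hv =>
    have hv' : σ.symm v ≠ 0 := σ.symm.map_ne_zero_iff.2 hv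
    refine ⟨⟨homIndex (σ.symm v), homIndex_lt _⟩, ?_⟩
    have h := mk_apply_eq_coordPoint σ (σ.symm v) hv' (by simpa using hv)
    simpa only [LinearEquiv.apply_symm_apply] using h

lemma coordPoint_injective (σ : (Fin 3 → ZMod 5) ≃ₗ[ZMod 5] (Fin 3 → ZMod 5)) :
    Function.Injective fun i : Fin 31 => coordPoint σ i := by
  intro i k h
  have key : ∀ i k : Fin 31, (∃ c : ZMod 5, c • homVec k = homVec i) → i = k := by
    decide +kernel
  obtain ⟨c, hc⟩ := (Projectivization.mk_eq_mk_iff' _ _ _ _ _).1 h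
  exact key i k ⟨c, σ.injective (by rw [map_smul, hc])⟩

/-- The `j`-th line of `PG(2,5)` in the coordinate system given by `σ`. -/
def coordLine (σ : (Fin 3 → ZMod 5) ≃ₗ[ZMod 5] (Fin 3 → ZMod 5)) (j : ℕ) : PGLine (ZMod 5) :=
  ⟨LinearMap.ker (dotProductEquiv (ZMod 5) (Fin 3) (homVec j) ∘ₗ σ.symm.toLinearMap), by
    have hne : dotProductEquiv (ZMod 5) (Fin 3) (homVec j) ∘ₗ σ.symm.toLinearMap ≠ 0 := by
      intro h
      refine homVec_ne_zero j ((dotProductEquiv (ZMod 5) (Fin 3)).map_eq_zero_iff.1 ?_)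
      refine LinearMap.ext fun x => ?_
      simpa using LinearMap.congr_fun h (σ x)
    have h := Module.Dual.finrank_ker_add_one_of_ne_zero hne
    rw [Module.finrank_fin_fun] at h
    omega⟩

lemma pgMem_coordLine (σ : (Fin 3 → ZMod 5) ≃ₗ[ZMod 5] (Fin 3 → ZMod 5)) (i j : ℕ) :
    PGMem (coordPoint σ i) (coordLine σ j) ↔ homVec j ⬝ᵥ homVec i = 0 := by
  simp [PGMem, coordPoint, coordLine, Projectivization.submodule_mk]

lemma coordLine_injective (σ : (Fin 3 → ZMod 5) ≃ₗ[ZMod 5] (Fin 3 → ZMod 5)) :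
    Function.Injective fun j : Fin 31 => coordLine σ j := by
  intro j k h
  have key : ∀ j k : Fin 31,
      (∀ i : Fin 31, homVec j ⬝ᵥ homVec i = 0 ↔ homVec k ⬝ᵥ homVec i = 0) → j = k := by
    decide +kernel
  refine key j k fun i => ?_
  rw [← pgMem_coordLine σ, ← pgMem_coordLine σ]
  exact iff_of_eq (congrArg _ h)

lemma exists_eq_coordLine (σ : (Fin 3 → ZMod 5) ≃ₗ[ZMod 5] (Fin 3 → ZMod 5))
    (ℓ : PGLine (ZMod 5)) : ∃ j : Fin 31, ℓ = coordLine σ j := by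
  obtain ⟨W, hW⟩ := ℓ
  have hlt : W < ⊤ := by
    refine lt_top_iff_ne_top.2 fun h => ?_
    rw [h, finrank_top, Module.finrank_fin_fun] at hW
    omega
  obtain ⟨f, hf, hWf⟩ := W.exists_le_ker_of_lt_top hlt
  obtain ⟨u, hu⟩ := (dotProductEquiv (ZMod 5) (Fin 3)).surjective (f ∘ₗ σ.toLinearMap)
  have hu0 : u ≠ 0 := by
    rintro rfl
    refine hf (LinearMap.ext fun x => ?_)
    simpa using (LinearMap.congr_fun hu (σ.symm x)).symm
  obtain ⟨c, hc⟩ := exists_smul_homVec_homIndex u hu0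
  have hc0 : c ≠ 0 := by
    rintro rfl
    exact hu0 (by rw [← hc, zero_smul])
  refine ⟨⟨homIndex u, homIndex_lt u⟩, Subtype.ext ?_⟩
  refine Submodule.eq_of_le_of_finrank_eq (fun x hx => ?_) (hW.trans (coordLine σ _).2.symm)
  have h1 : f x = 0 := hWf hx
  have h2 := LinearMap.congr_fun hu (σ.symm x)
  rw [← hc] at h2
  simpa [coordLine, h1, hc0] using h2

open Classical in
/-- The bit mask of a set of points in the coordinate system given by `σ`. -/
def coordMask (σ : (Fin 3 → ZMod 5) ≃ₗ[ZMod 5] (Fin 3 → ZMod 5)) (S : Set (PGPoint (ZMod 5))) :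
    ℕ :=
  Nat.ofBits fun i : Fin 31 => decide (coordPoint σ i ∈ S)

lemma testBit_coordMask (σ : (Fin 3 → ZMod 5) ≃ₗ[ZMod 5] (Fin 3 → ZMod 5))
    (S : Set (PGPoint (ZMod 5))) (i : Fin 31) :
    (coordMask σ S).testBit i = true ↔ coordPoint σ i ∈ S := by
  simp [coordMask]

lemma testBit_coordMask_homIndex (σ : (Fin 3 → ZMod 5) ≃ₗ[ZMod 5] (Fin 3 → ZMod 5))
    (S : Set (PGPoint (ZMod 5))) (v : Fin 3 → ZMod 5) (hv : v ≠ 0) (hσ : σ v ≠ 0) :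
    (coordMask σ S).testBit (homIndex v) = true ↔ Projectivization.mk (ZMod 5) (σ v) hσ ∈ S := by
  rw [mk_apply_eq_coordPoint σ v hv]
  exact testBit_coordMask σ S ⟨homIndex v, homIndex_lt v⟩

lemma pgTangent_iff (σ : (Fin 3 → ZMod 5) ≃ₗ[ZMod 5] (Fin 3 → ZMod 5))
    (S : Set (PGPoint (ZMod 5))) (i j : Fin 31) :
    PGTangent S (coordLine σ j) (coordPoint σ i) ↔
      coordMask σ S &&& lineMask j = 2 ^ (i : ℕ) := by
  have hbit (k : Fin 31) : (coordMask σ S &&& lineMask j).testBit k = true ↔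
      coordPoint σ k ∈ S ∩ {x | PGMem x (coordLine σ j)} := by
    rw [Nat.testBit_and, Bool.and_eq_true, testBit_coordMask, testBit_lineMask, decide_eq_true_eq,
      ← pgMem_coordLine σ]
    rfl
  constructor
  · intro h
    refine Nat.eq_of_testBit_eq fun k => ?_
    by_cases hk : k < 31
    · rw [Bool.eq_iff_iff, hbit ⟨k, hk⟩, h, Set.mem_singleton_iff,
        (coordPoint_injective σ).eq_iff (a := ⟨k, hk⟩) (b := i), Nat.testBit_two_pow,
        decide_eq_true_eq, Fin.ext_iff, eq_comm]
    · have hik : (i : ℕ) ≠ k := by have := i.2; omega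
      rw [Nat.testBit_and, lineMask, Nat.testBit_ofBits_ge _ _ (by omega), Bool.and_false,
        Nat.testBit_two_pow_of_ne hik]
  · intro h
    refine Set.ext fun x => ?_
    obtain ⟨k, rfl⟩ := exists_eq_coordPoint σ x
    rw [← hbit, h, Nat.testBit_two_pow, decide_eq_true_eq, Set.mem_singleton_iff,
      (coordPoint_injective σ).eq_iff (a := k) (b := i), Fin.ext_iff, eq_comm]

lemma isSemiarcMask_coordMask (σ : (Fin 3 → ZMod 5) ≃ₗ[ZMod 5] (Fin 3 → ZMod 5))
    {S : Set (PGPoint (ZMod 5))} (hS : IsTwoSemiarc S) : IsSemiarcMask (coordMask σ S) := by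
  intro i hi
  refine Eq.trans ?_ (hS.2 _ ((testBit_coordMask σ S i).1 hi))
  rw [← Set.ncard_coe_finset,
    ← Set.ncard_image_of_injective _ (coordLine_injective σ)]
  congr 1
  refine Set.ext fun ℓ => ?_
  obtain ⟨j, rfl⟩ := exists_eq_coordLine σ ℓ
  rw [(coordLine_injective σ).mem_set_image (a := j)]
  simp [pgTangent_iff]

lemma countP_testBit_coordMask (σ : (Fin 3 → ZMod 5) ≃ₗ[ZMod 5] (Fin 3 → ZMod 5))
    (S : Set (PGPoint (ZMod 5))) :
    (List.range 31).countP (coordMask σ S).testBit = S.ncard := by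
  have hrange : List.range 31 = (List.finRange 31).map (Fin.val : Fin 31 → ℕ) :=
    List.map_coe_finRange_eq_range.symm
  rw [hrange, List.countP_map, countP_finRange, ← Set.ncard_coe_finset,
    ← Set.ncard_image_of_injective _ (coordPoint_injective σ)]
  congr 1
  refine Set.ext fun x => ?_
  obtain ⟨i, rfl⟩ := exists_eq_coordPoint σ x
  rw [(coordPoint_injective σ).mem_set_image (a := i)]
  simp [testBit_coordMask]

lemma ncard_points_on_line (ℓ : PGLine (ZMod 5)) : {P | PGMem P ℓ}.ncard = 6 := by
  have key : ∀ j : Fin 31,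
      (Finset.univ.filter fun i : Fin 31 => homVec j ⬝ᵥ homVec i = 0).card = 6 := by
    decide +kernel
  obtain ⟨j, rfl⟩ := exists_eq_coordLine (LinearEquiv.refl _ _) ℓ
  rw [← key j, ← Set.ncard_coe_finset,
    ← Set.ncard_image_of_injective _ (coordPoint_injective (LinearEquiv.refl _ _))]
  congr 1
  refine Set.ext fun x => ?_
  obtain ⟨i, rfl⟩ := exists_eq_coordPoint (LinearEquiv.refl _ _) x
  rw [(coordPoint_injective _).mem_set_image (a := i)]
  simp [pgMem_coordLine]

/-- A basis of `F³` gives a linear automorphism mapping the standard basis to it. -/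
lemma exists_linearEquiv_of_linearIndependent {b : Fin 3 → Fin 3 → ZMod 5}
    (hb : LinearIndependent (ZMod 5) b) :
    ∃ σ : (Fin 3 → ZMod 5) ≃ₗ[ZMod 5] (Fin 3 → ZMod 5), ∀ x, σ x = ∑ i, x i • b i := by
  refine ⟨(basisOfLinearIndependentOfCardEqFinrank hb (by simp)).equivFun.symm, fun x => ?_⟩
  rw [Module.Basis.equivFun_symm_apply, coe_basisOfLinearIndependentOfCardEqFinrank]

lemma exists_linearIndependent_of_six_lt_ncard {S : Set (PGPoint (ZMod 5))} (hS : 6 < S.ncard) :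
    ∃ b : Fin 3 → Fin 3 → ZMod 5, LinearIndependent (ZMod 5) b ∧
      ∀ i, ∃ h : b i ≠ 0, Projectivization.mk (ZMod 5) (b i) h ∈ S := by
  obtain ⟨P, hP, Q, hQ, hPQ⟩ := (Set.one_lt_ncard (s := S)).1 (by omega)
  have hli : LinearIndependent (ZMod 5) ![P.rep, Q.rep] := by
    have h := Projectivization.independent_iff.1
      ((Projectivization.independent_pair_iff_ne P Q).2 hPQ)
    have hrep : Projectivization.rep ∘ ![P, Q] = ![P.rep, Q.rep] := by
      ext i : 1
      fin_cases i <;> rfl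
    rw [hrep] at h
    exact h
  let ℓ : PGLine (ZMod 5) := ⟨Submodule.span (ZMod 5) (Set.range ![P.rep, Q.rep]), by
    rw [finrank_span_eq_card hli, Fintype.card_fin]⟩
  obtain ⟨R, hR, hRℓ⟩ : ∃ R ∈ S, ¬ PGMem R ℓ := by
    by_contra! h
    have h1 : S.ncard ≤ {P | PGMem P ℓ}.ncard :=
      Set.ncard_le_ncard h (Set.finite_of_ncard_ne_zero (by rw [ncard_points_on_line]; omega))
    rw [ncard_points_on_line] at h1
    omega
  rw [PGMem, Projectivization.submodule_eq, Submodule.span_singleton_le_iff_mem] at hRℓ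
  refine ⟨![R.rep, P.rep, Q.rep], hli.finCons hRℓ, fun i => ?_⟩
  have hrep {X : PGPoint (ZMod 5)} (hX : X ∈ S) :
      ∃ h : X.rep ≠ 0, Projectivization.mk (ZMod 5) X.rep h ∈ S :=
    ⟨X.rep_nonzero, by rwa [X.mk_rep]⟩
  fin_cases i
  exacts [hrep hR, hrep hP, hrep hQ]

lemma testBit_coordMask_basis {S : Set (PGPoint (ZMod 5))} {b : Fin 3 → Fin 3 → ZMod 5}
    (hbS : ∀ i, ∃ h : b i ≠ 0, Projectivization.mk (ZMod 5) (b i) h ∈ S)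
    {σ : (Fin 3 → ZMod 5) ≃ₗ[ZMod 5] (Fin 3 → ZMod 5)} (hσ : ∀ x, σ x = ∑ i, x i • b i)
    {k : ℕ} (hk : (2 ^ 0 + 2 ^ 1 + 2 ^ 6).testBit k = true) :
    (coordMask σ S).testBit k = true := by
  have hsingle (i : Fin 3) :
      (coordMask σ S).testBit (homIndex (Pi.single i 1)) = true := by
    have hi : σ (Pi.single i 1) = b i := by simp [hσ, Pi.single_apply]
    obtain ⟨h, hS⟩ := hbS i
    rw [testBit_coordMask_homIndex σ S _ (by simp) (by rwa [hi])]
    simpa only [hi] using hS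
  have hk7 : k < 7 := by
    by_contra! h
    rw [Nat.testBit_lt_two_pow (lt_of_lt_of_le (by norm_num : _ < 2 ^ 7)
      (Nat.pow_le_pow_right (by norm_num) h))] at hk
    cases hk
  have h0 : homIndex (Pi.single 0 1) = 6 := by decide +kernel
  have h1 : homIndex (Pi.single 1 1) = 1 := by decide +kernel
  have h2 : homIndex (Pi.single 2 1) = 0 := by decide +kernel
  interval_cases k
  exacts [h2 ▸ hsingle 2, h1 ▸ hsingle 1, absurd hk (by decide), absurd hk (by decide),
    absurd hk (by decide), absurd hk (by decide), h0 ▸ hsingle 0]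

lemma exists_hasTriangle_coordMask {S : Set (PGPoint (ZMod 5))} (hS : IsTwoSemiarc S)
    (hcard : S.ncard = 9) :
    ∃ σ : (Fin 3 → ZMod 5) ≃ₗ[ZMod 5] (Fin 3 → ZMod 5), HasTriangle (coordMask σ S) := by
  obtain ⟨b, hb, hbS⟩ := exists_linearIndependent_of_six_lt_ncard (S := S) (by omega)
  obtain ⟨σ, hσ⟩ := exists_linearEquiv_of_linearIndependent hb
  have hbit := fun k => testBit_coordMask_basis hbS hσ (k := k)
  by_cases h : ∃ x : Fin 3 → ZMod 5, (∀ i, x i ≠ 0) ∧ (coordMask σ S).testBit (homIndex x) = true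
  · obtain ⟨x, hx, hxS⟩ := h
    have hb' := hb.units_smul fun i => Units.mk0 (x i) (hx i)
    obtain ⟨τ, hτ⟩ := exists_linearEquiv_of_linearIndependent hb'
    have hτ1 : τ 1 = σ x := by simp [hτ, hσ, Units.smul_def]
    have hb'S : ∀ i, ∃ h : ((fun i => Units.mk0 (x i) (hx i)) • b) i ≠ 0,
        Projectivization.mk (ZMod 5) (((fun i => Units.mk0 (x i) (hx i)) • b) i) h ∈ S := by
      intro i
      obtain ⟨h, hi⟩ := hbS i
      refine ⟨hb'.ne_zero i, ?_⟩
      convert hi using 1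
      exact (Projectivization.mk_eq_mk_iff' _ _ _ _ _).2 ⟨x i, rfl⟩
    refine ⟨τ, hasTriangle_of_search (isSemiarcMask_coordMask τ hS) 31 9 _ _ search_frame
      (fun k hk => ?_) (by simp) (by rw [countP_testBit_coordMask, hcard])⟩
    have hx0 : x ≠ 0 := fun h => hx 0 (congrFun h 0)
    have h12 : (coordMask τ S).testBit 12 = true := by
      have h1 : homIndex 1 = 12 := by decide +kernel
      have hσx : σ x ≠ 0 := σ.map_ne_zero_iff.2 hx0
      rw [← h1, testBit_coordMask_homIndex τ S 1 one_ne_zero (by rwa [hτ1])]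
      rw [testBit_coordMask_homIndex σ S x hx0 hσx] at hxS
      simpa only [hτ1] using hxS
    by_cases hk12 : k = 12
    · rwa [hk12]
    · refine testBit_coordMask_basis hb'S hτ ?_
      have hor : 2 ^ 0 + 2 ^ 1 + 2 ^ 6 + 2 ^ 12 = (2 ^ 0 + 2 ^ 1 + 2 ^ 6) ||| 2 ^ 12 := by decide
      rw [hor, Nat.testBit_or, Nat.testBit_two_pow_of_ne (Ne.symm hk12), Bool.or_false] at hk
      exact hk
  · push Not at h
    refine ⟨σ, hasTriangle_of_search (isSemiarcMask_coordMask σ hS) 31 9 _ _ search_sides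
      hbit (fun k hk => ?_) (by rw [countP_testBit_coordMask, hcard])⟩
    have key : ∀ k : Fin 31, Nat.testBit 2078208000 k = true →
        (∀ i, homVec k i ≠ 0) ∧ homIndex (homVec k) = k := by
      decide +kernel
    have hk31 : k < 31 := by
      by_contra! hk'
      rw [Nat.testBit_lt_two_pow (lt_of_lt_of_le (by norm_num : _ < 2 ^ 31)
        (Nat.pow_le_pow_right (by norm_num) hk'))] at hk
      cases hk
    obtain ⟨h1, h2⟩ := key ⟨k, hk31⟩ hk
    rw [← Bool.not_eq_true]
    have h3 := h _ h1
    rwa [h2] at h3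

lemma nine_le_ncard_projTriangle : 9 ≤ projTriangle.ncard := by
  let I : Finset (Fin 31) := {0, 1, 2, 5, 6, 7, 10, 11, 26}
  have hI : ((fun i : Fin 31 => coordPoint (LinearEquiv.refl _ _) i) '' I).ncard = 9 := by
    rw [Set.ncard_image_of_injective _ (coordPoint_injective _), Set.ncard_coe_finset]
    rfl
  have hfin : projTriangle.Finite := by
    simp only [projTriangle, Set.finite_insert, Set.finite_singleton]
  rw [← hI]
  refine Set.ncard_le_ncard ?_ hfin
  have key : ∀ i ∈ I, ∃ v ∈ ([![1, 0, 0], ![0, 1, 0], ![0, 0, 1], ![1, 1, 0], ![4, 1, 0],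
      ![1, 0, 1], ![4, 0, 1], ![0, 1, 1], ![0, 4, 1]] : List (Fin 3 → ZMod 5)),
      ∃ c : ZMod 5, c • v = homVec i := by
    decide +kernel
  rintro _ ⟨i, hi, rfl⟩
  obtain ⟨v, hv, c, hc⟩ := key i hi
  have hP (h : v ≠ 0) : coordPoint (LinearEquiv.refl _ _) i = Projectivization.mk (ZMod 5) v h :=
    (Projectivization.mk_eq_mk_iff' _ _ _ _ _).2 ⟨c, hc⟩
  simp only [List.mem_cons, List.not_mem_nil, or_false] at hv
  rcases hv with rfl | rfl | rfl | rfl | rfl | rfl | rfl | rfl | rfl <;>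
    simp [hP (by decide), projTriangle]

/-- Every 2-semiarc of size 9 in `PG(2,5)` is projectively equivalent to the
projective triangle. -/
theorem two_semiarc_PG2_5_size_nine (S : Set (PGPoint (ZMod 5)))
    (hS : IsTwoSemiarc S) (hcard : S.ncard = 9) :
    ∃ σ : (Fin 3 → ZMod 5) ≃ₗ[ZMod 5] (Fin 3 → ZMod 5),
      Projectivization.map σ.toLinearMap σ.injective '' projTriangle = S := by
  obtain ⟨σ, u, v, w, hdet, hbits⟩ := exists_hasTriangle_coordMask hS hcard
  have hli : LinearIndependent (ZMod 5) ![u, v, w] :=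
    Matrix.linearIndependent_rows_of_det_ne_zero hdet
  obtain ⟨τ, hτ⟩ := exists_linearEquiv_of_linearIndependent hli
  have hτ' (x y z : ZMod 5) : τ ![x, y, z] = x • u + y • v + z • w := by
    simp [hτ, Fin.sum_univ_three]
  have hmem {y : Fin 3 → ZMod 5} (hy : y ≠ 0) (c : ZMod 5) (x : Fin 3 → ZMod 5)
      (hx : x ∈ [u, v, w, u + v, u - v, u + w, u - w, v + w, v - w]) (hxy : c • x = τ y) :
      Projectivization.map (τ.trans σ).toLinearMap (τ.trans σ).injective
        (Projectivization.mk (ZMod 5) y hy) ∈ S := by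
    have hx0 : x ≠ 0 := by
      rintro rfl
      rw [smul_zero] at hxy
      exact hy (τ.map_eq_zero_iff.1 hxy.symm)
    have h := (testBit_coordMask_homIndex σ S x hx0 (σ.map_ne_zero_iff.2 hx0)).1 (hbits x hx)
    convert h using 1
    rw [Projectivization.map_mk]
    refine (Projectivization.mk_eq_mk_iff' _ _ _ _ _).2 ⟨c, ?_⟩
    rw [← map_smul, hxy]
    rfl
  have h4 : (4 : ZMod 5) = -1 := by decide
  refine ⟨τ.trans σ, Set.eq_of_subset_of_ncard_le ?_ ?_
    (Set.finite_of_ncard_ne_zero (by omega))⟩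
  · rintro _ ⟨P, hP, rfl⟩
    simp only [projTriangle, Set.mem_insert_iff, Set.mem_singleton_iff] at hP
    rcases hP with rfl | rfl | rfl | rfl | rfl | rfl | rfl | rfl | rfl
    · exact hmem _ 1 u (by simp) (by simp [hτ'])
    · exact hmem _ 1 v (by simp) (by simp [hτ'])
    · exact hmem _ 1 w (by simp) (by simp [hτ'])
    · exact hmem _ 1 (u + v) (by simp) (by simp [hτ'])
    · exact hmem _ (-1) (u - v) (by simp) (by simp [hτ', h4]; abel)
    · exact hmem _ 1 (u + w) (by simp) (by simp [hτ'])
    · exact hmem _ (-1) (u - w) (by simp) (by simp [hτ', h4]; abel)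
    · exact hmem _ 1 (v + w) (by simp) (by simp [hτ'])
    · exact hmem _ (-1) (v - w) (by simp) (by simp [hτ', h4]; abel)
  · rw [Set.ncard_image_of_injective _ (Projectivization.map_injective _ _), hcard]
    exact nine_le_ncard_projTriangle
end
end
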